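/- arXiv:1701.01813 — 3 statements merged into one kernel-verified Lean document; each statement's English description precedes it below -/
import Mathlib

section
/- Let ρ = β + iγ run over the non-trivial zeros of the Riemann zeta function and let α > 1 be a real parameter. The series ∑_{ρ: γ>0} γ^{β−1/2}·∫_1^∞ exp(−γ·arctan(1/u))·u^{−α−β} du converges if α > 3/2, and does not converge if α ≤ 3/2. Moreover, for any fixed c ≥ 0, the series with an additional factor log^c(u) inserted in the integrand converges for α > 3/2. -/
open Complex

noncomputable section

/-- The non-trivial zeros of the Riemann zeta function. -/
def zetaZeros : Set ℂ := {ρ | riemannZeta ρ = 0 ∧ 0 < ρ.re ∧ ρ.re < 1}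

/-- The non-trivial zeros with positive imaginary part. -/
def upperZeros : Set ℂ := {ρ | ρ ∈ zetaZeros ∧ 0 < ρ.im}

theorem norm_sin_le_exp_abs_im (z : ℂ) : ‖Complex.sin z‖ ≤ Real.exp |z.im| := by
  have h1 : ‖Complex.exp (-z * I)‖ ≤ Real.exp |z.im| := by
    rw [Complex.norm_exp]; simpa using le_abs_self z.im
  have h2 : ‖Complex.exp (z * I)‖ ≤ Real.exp |z.im| := by
    rw [Complex.norm_exp]; simpa using neg_le_abs z.im
  rw [Complex.sin, norm_div, norm_mul, norm_I, mul_one]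
  have := norm_sub_le (Complex.exp (-z * I)) (Complex.exp (z * I))
  have h3 : ‖(2 : ℂ)‖ = 2 := by simp
  rw [h3]
  linarith

theorem norm_cos_ge_of_one_le_im {z : ℂ} (hz : 1 ≤ z.im) :
    Real.exp z.im / 4 ≤ ‖Complex.cos z‖ := by
  have h1 : ‖Complex.exp (-z * I)‖ = Real.exp z.im := by
    rw [Complex.norm_exp]; simp
  have h2 : ‖Complex.exp (z * I)‖ = Real.exp (-z.im) := by
    rw [Complex.norm_exp]; simp
  have h3 := norm_sub_norm_le (Complex.exp (-z * I)) (-Complex.exp (z * I))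
  rw [Complex.cos, norm_div]
  have h4 : ‖(2 : ℂ)‖ = 2 := by simp
  rw [h4]
  rw [norm_neg, sub_neg_eq_add, h1, h2, add_comm (Complex.exp (-z * I))] at h3
  have h5 : Real.exp (-z.im) ≤ 1 := Real.exp_le_one_iff.2 (by linarith)
  have h6 : 2 ≤ Real.exp z.im := by linarith [Real.add_one_le_exp z.im]
  linarith

theorem norm_Gamma_half_add_ge {z : ℂ} (hz : z.re = 1 / 2) :
    Real.exp (-(Real.pi * |z.im| / 2)) ≤ ‖Complex.Gamma z‖ := by
  have hc : 1 - z = (starRingEnd ℂ) z := by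
    apply Complex.ext <;> simp [hz]; norm_num
  have h := Complex.Gamma_mul_Gamma_one_sub z
  rw [hc, Complex.Gamma_conj] at h
  have h' := congrArg norm h
  rw [norm_mul, Complex.norm_conj, norm_div, Complex.norm_real, Real.norm_of_nonneg Real.pi_pos.le]
    at h'
  have hs := norm_sin_le_exp_abs_im (Real.pi * z)
  have him : ((Real.pi : ℂ) * z).im = Real.pi * z.im := by simp
  rw [him, abs_mul, abs_of_pos Real.pi_pos] at hs
  have hG : Complex.Gamma z ≠ 0 := Complex.Gamma_ne_zero_of_re_pos (by rw [hz]; norm_num)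
  have hs0 : 0 < ‖Complex.sin (Real.pi * z)‖ := by
    rcases (norm_nonneg (Complex.sin (Real.pi * z))).lt_or_eq with h0 | h0
    · exact h0
    · rw [← h0, div_zero] at h'
      exact absurd h' (mul_self_ne_zero.2 (norm_ne_zero_iff.2 hG))
  have h1 : Real.exp (-(Real.pi * |z.im|)) ≤ ‖Complex.Gamma z‖ * ‖Complex.Gamma z‖ := by
    rw [h', Real.exp_neg, inv_eq_one_div]
    gcongr
    linarith [Real.pi_gt_three]
  have h2 : Real.exp (-(Real.pi * |z.im|)) =
      Real.exp (-(Real.pi * |z.im| / 2)) * Real.exp (-(Real.pi * |z.im| / 2)) := by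
    rw [← Real.exp_add]; congr 1; ring
  rw [h2] at h1
  exact abs_le_of_sq_le_sq' (by nlinarith) (norm_nonneg _) |>.2

theorem norm_betaIntegral_le (u v : ℂ) :
    ‖betaIntegral u v‖ ≤ ‖betaIntegral u.re v.re‖ := by
  have key : (betaIntegral u.re v.re) =
      ((∫ x in (0:ℝ)..1, x ^ (u.re - 1) * (1 - x) ^ (v.re - 1) : ℝ) : ℂ) := by
    rw [betaIntegral, ← intervalIntegral.integral_ofReal]
    apply intervalIntegral.integral_congr
    intro x hx
    rw [Set.uIcc_of_le zero_le_one] at hx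
    simp only
    rw [Complex.ofReal_mul, Complex.ofReal_cpow hx.1, Complex.ofReal_cpow (by linarith [hx.2])]
    simp
  rw [key, Complex.norm_real]
  refine le_trans ?_ (le_abs_self _)
  rw [betaIntegral]
  refine (intervalIntegral.norm_integral_le_integral_norm zero_le_one).trans (le_of_eq ?_)
  apply intervalIntegral.integral_congr_ae
  have : ∀ᵐ x : ℝ, x ≠ 1 := by simp [MeasureTheory.ae_iff, MeasureTheory.measure_singleton]
  filter_upwards [this] with x hx1 hx
  rw [Set.uIoc_of_le zero_le_one] at hx
  have hx2 : 0 < 1 - x := sub_pos.2 (lt_of_le_of_ne hx.2 hx1)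
  rw [norm_mul, Complex.norm_cpow_eq_rpow_re_of_pos hx.1]
  have : (1 - (x : ℂ)) = ((1 - x : ℝ) : ℂ) := by push_cast; rfl
  rw [this, Complex.norm_cpow_eq_rpow_re_of_pos hx2]
  simp

theorem norm_Gamma_mul_Gamma_re_le {u : ℂ} (hu : 0 < u.re) {δ : ℝ} (hδ : 0 < δ) :
    ‖Complex.Gamma u‖ * Real.Gamma (u.re + δ) ≤ ‖Complex.Gamma (u + δ)‖ * Real.Gamma u.re := by
  have h1 := Complex.Gamma_mul_Gamma_eq_betaIntegral (s := u) (t := δ) hu (by simpa)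
  have h2 := Complex.Gamma_mul_Gamma_eq_betaIntegral (s := u.re) (t := δ) (by simpa) (by simpa)
  have hB := norm_betaIntegral_le u δ
  rw [Complex.ofReal_re] at hB
  have e1 := congrArg norm h1
  have e2 := congrArg norm h2
  rw [← Complex.ofReal_add] at e2
  simp only [norm_mul, Complex.Gamma_ofReal, Complex.norm_real] at e1 e2
  rw [Real.norm_of_nonneg (Real.Gamma_pos_of_pos hδ).le] at e1 e2
  rw [Real.norm_of_nonneg (Real.Gamma_pos_of_pos hu).le,
    Real.norm_of_nonneg (Real.Gamma_pos_of_pos (by positivity : 0 < u.re + δ)).le] at e2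
  have hδ' := Real.Gamma_pos_of_pos hδ
  have hs := Real.Gamma_pos_of_pos (by positivity : 0 < u.re + δ)
  refine le_of_mul_le_mul_right ?_ hδ'
  calc ‖Complex.Gamma u‖ * Real.Gamma (u.re + δ) * Real.Gamma δ
      = ‖Complex.Gamma (u + δ)‖ * ‖betaIntegral u δ‖ * Real.Gamma (u.re + δ) := by
        rw [← e1]; ring
    _ ≤ ‖Complex.Gamma (u + δ)‖ * ‖betaIntegral u.re δ‖ * Real.Gamma (u.re + δ) := by gcongr
    _ = ‖Complex.Gamma (u + δ)‖ * Real.Gamma u.re * Real.Gamma δ := by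
        rw [mul_assoc _ (Real.Gamma u.re), e2]; ring

theorem exists_norm_Gamma_ge : ∃ c : ℝ, 0 < c ∧ ∀ (n : ℕ) (w : ℂ), n + 1 / 2 ≤ w.re →
    w.re ≤ n + 3 / 2 → 0 < w.im →
    c * w.im ^ n * Real.exp (-(Real.pi * w.im / 2)) ≤ ‖Complex.Gamma w‖ := by
  obtain ⟨x, hx, hmin⟩ := isCompact_Icc.exists_isMinOn (s := Set.Icc (1 / 2 : ℝ) (3 / 2))
    (Set.nonempty_Icc.2 (by norm_num)) (f := Real.Gamma) (by
      intro y hy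
      refine (Real.differentiableAt_Gamma fun m => ?_).continuousAt.continuousWithinAt
      have : (0 : ℝ) ≤ m := m.cast_nonneg
      linarith [hy.1])
  have hG : 0 < Real.Gamma x := Real.Gamma_pos_of_pos (by linarith [hx.1])
  have hG2 : 0 < Real.Gamma (1 / 2) := Real.Gamma_pos_of_pos (by norm_num)
  refine ⟨Real.Gamma x / Real.Gamma (1 / 2), by positivity, fun n => ?_⟩
  induction n with
  | zero =>
    intro w h1 h2 h3
    norm_num at h1 h2
    have hb := norm_Gamma_half_add_ge (z := ⟨1 / 2, w.im⟩) rfl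
    simp only [abs_of_pos h3] at hb
    have hx' : Real.Gamma x ≤ Real.Gamma w.re := hmin ⟨by linarith, by linarith⟩
    have key : ‖Complex.Gamma ⟨1 / 2, w.im⟩‖ * Real.Gamma w.re
        ≤ ‖Complex.Gamma w‖ * Real.Gamma (1 / 2) := by
      rcases h1.lt_or_eq with h | h
      · have := norm_Gamma_mul_Gamma_re_le (u := ⟨1 / 2, w.im⟩) (by norm_num) (sub_pos.2 h)
        have e : (⟨1 / 2, w.im⟩ : ℂ) + ((w.re - 1 / 2 : ℝ) : ℂ) = w := by
          apply Complex.ext <;> simp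
        rw [e] at this
        simpa using this
      · have e : (⟨1 / 2, w.im⟩ : ℂ) = w := by
          apply Complex.ext <;> simp [h]
        rw [e, ← h]
    rw [pow_zero, mul_one, div_mul_eq_mul_div, div_le_iff₀ hG2]
    refine le_trans ?_ key
    rw [mul_comm]
    gcongr
  | succ n ih =>
    intro w h1 h2 h3
    push_cast at h1 h2
    have hw : w - 1 ≠ 0 := fun h => by
      have := congrArg Complex.im h
      simp at this
      linarith
    have hrec := Complex.Gamma_add_one (w - 1) hw
    rw [sub_add_cancel] at hrec
    have h := ih (w - 1) (by simp; linarith) (by simp; linarith) (by simpa)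
    have him : (w - 1).im = w.im := by simp
    rw [him] at h
    have hn : w.im ≤ ‖w - 1‖ := by
      rw [← him]; exact (le_abs_self _).trans (Complex.abs_im_le_norm _)
    rw [hrec, norm_mul, pow_succ]
    calc _ = w.im * (Real.Gamma x / Real.Gamma (1 / 2) * w.im ^ n *
          Real.exp (-(Real.pi * w.im / 2))) := by ring
      _ ≤ _ := by gcongr

theorem exists_norm_zeta_one_sub_ge : ∃ c : ℝ, 0 < c ∧ ∀ w : ℂ, 1 / 2 ≤ w.re → 1 ≤ w.im →
    c * (2 * Real.pi) ^ (-w.re) * w.im ^ (w.re - 3 / 2) * ‖riemannZeta w‖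
      ≤ ‖riemannZeta (1 - w)‖ := by
  obtain ⟨c, hc, hG⟩ := exists_norm_Gamma_ge
  refine ⟨c / 2, by positivity, fun w hre him => ?_⟩
  have hfe := riemannZeta_one_sub (s := w)
    (fun n h => by have := congrArg Complex.im h; simp at this; linarith)
    (fun h => by have := congrArg Complex.im h; simp at this; linarith)
  set n := ⌊w.re - 1 / 2⌋₊ with hn
  have hn1 : (n : ℝ) ≤ w.re - 1 / 2 := Nat.floor_le (by linarith)
  have hn2 : w.re - 1 / 2 < n + 1 := Nat.lt_floor_add_one _
  have hG' := hG n w (by linarith) (by linarith) (by linarith)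
  have hcos := norm_cos_ge_of_one_le_im (z := Real.pi * w / 2) (by
    have : ((Real.pi : ℂ) * w / 2).im = Real.pi * w.im / 2 := by simp
    rw [this]; nlinarith [Real.pi_gt_three])
  have e1 : ((Real.pi : ℂ) * w / 2).im = Real.pi * w.im / 2 := by simp
  rw [e1] at hcos
  have hp : ‖(2 * (Real.pi : ℂ)) ^ (-w)‖ = (2 * Real.pi) ^ (-w.re) := by
    have : (2 * (Real.pi : ℂ)) = ((2 * Real.pi : ℝ) : ℂ) := by push_cast; rfl
    rw [this, Complex.norm_cpow_eq_rpow_re_of_pos (by positivity)]; simp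
  have hpow : w.im ^ (w.re - 3 / 2) ≤ w.im ^ n := by
    rw [← Real.rpow_natCast]
    exact Real.rpow_le_rpow_of_exponent_le him (by linarith)
  rw [hfe, norm_mul, norm_mul, norm_mul, norm_mul, hp]
  have h2 : ‖(2 : ℂ)‖ = 2 := by simp
  rw [h2]
  have hexp : Real.exp (-(Real.pi * w.im / 2)) * Real.exp (Real.pi * w.im / 2) = 1 := by
    rw [← Real.exp_add]; simp
  calc c / 2 * (2 * Real.pi) ^ (-w.re) * w.im ^ (w.re - 3 / 2) * ‖riemannZeta w‖
      ≤ c / 2 * (2 * Real.pi) ^ (-w.re) * w.im ^ n * ‖riemannZeta w‖ := by gcongr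
    _ = 2 * (2 * Real.pi) ^ (-w.re) * (c * w.im ^ n * Real.exp (-(Real.pi * w.im / 2))) *
        (Real.exp (Real.pi * w.im / 2) / 4) * ‖riemannZeta w‖ := by
      linear_combination (-c / 2 * (2 * Real.pi) ^ (-w.re) * w.im ^ n * ‖riemannZeta w‖) * hexp
    _ ≤ _ := by gcongr

theorem one_quarter_le_norm_riemannZeta {s : ℂ} (hs : 2 ≤ s.re) : 1 / 4 ≤ ‖riemannZeta s‖ := by
  have hz := zeta_eq_tsum_one_div_nat_add_one_cpow (s := s) (by linarith)
  have hsum : Summable fun n : ℕ => (1 : ℝ) / ((n : ℝ) + 1) ^ 2 := by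
    have := (summable_nat_add_iff 1).2 hasSum_zeta_two.summable
    simpa using this
  have hb : ∀ n : ℕ, ‖1 / ((n : ℂ) + 1) ^ s‖ ≤ 1 / ((n : ℝ) + 1) ^ 2 := fun n => by
    have e : ((n : ℂ) + 1) = (((n : ℝ) + 1 : ℝ) : ℂ) := by push_cast; rfl
    rw [norm_div, norm_one, e, Complex.norm_cpow_eq_rpow_re_of_pos (by positivity)]
    gcongr
    rw [← Real.rpow_natCast]
    exact Real.rpow_le_rpow_of_exponent_le (by linarith [n.cast_nonneg (α := ℝ)]) (by simpa)
  have hsC : Summable fun n : ℕ => 1 / ((n : ℂ) + 1) ^ s := Summable.of_norm_bounded hsum hb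
  have htot : ∑' n : ℕ, (1 : ℝ) / ((n : ℝ) + 1) ^ 2 = Real.pi ^ 2 / 6 := by
    have := hasSum_zeta_two.summable.sum_add_tsum_nat_add 1
    rw [hasSum_zeta_two.tsum_eq] at this
    simpa using this
  rw [hsC.tsum_eq_zero_add] at hz
  rw [hsum.tsum_eq_zero_add] at htot
  simp only [Nat.cast_zero, zero_add, Complex.one_cpow, div_one, one_pow] at hz htot
  have hle : ‖∑' n : ℕ, 1 / (((n + 1 : ℕ) : ℂ) + 1) ^ s‖
      ≤ ∑' n : ℕ, (1 : ℝ) / (((n + 1 : ℕ) : ℝ) + 1) ^ 2 :=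
    tsum_of_norm_bounded ((summable_nat_add_iff 1).2 hsum).hasSum fun n => hb (n + 1)
  rw [hz]
  have h1 := norm_sub_le (1 + ∑' n : ℕ, 1 / (((n + 1 : ℕ) : ℂ) + 1) ^ s)
    (∑' n : ℕ, 1 / (((n + 1 : ℕ) : ℂ) + 1) ^ s)
  rw [add_sub_cancel_right, norm_one] at h1
  nlinarith [Real.pi_lt_d2, Real.pi_gt_three]

/-- The function `{t}` on `(1, ∞)`, extended by zero. -/
def fractIndicator : ℝ → ℂ := (Set.Ioi (1 : ℝ)).indicator fun t => ((Int.fract t : ℝ) : ℂ)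

theorem norm_fractIndicator_le (t : ℝ) : ‖fractIndicator t‖ ≤ 1 := by
  unfold fractIndicator
  refine (norm_indicator_le_norm_self _ _).trans ?_
  rw [Complex.norm_real, Real.norm_of_nonneg (Int.fract_nonneg t)]
  exact (Int.fract_lt_one t).le

theorem measurable_fractIndicator : Measurable fractIndicator :=
  (Complex.measurable_ofReal.comp measurable_fract).indicator measurableSet_Ioi

theorem mellin_fractIndicator (s : ℂ) : mellin fractIndicator (-s) =
    ∫ t in Set.Ioi (1 : ℝ), ((Int.fract t : ℝ) : ℂ) * (t : ℂ) ^ (-(s + 1)) := by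
  have e : ∀ t : ℝ, (t : ℂ) ^ (-s - 1) • fractIndicator t =
      (Set.Ioi (1 : ℝ)).indicator
        (fun t : ℝ => ((Int.fract t : ℝ) : ℂ) * (t : ℂ) ^ (-(s + 1))) t := fun t => by
    unfold fractIndicator
    by_cases ht : t ∈ Set.Ioi (1 : ℝ)
    · rw [Set.indicator_of_mem ht, Set.indicator_of_mem ht, smul_eq_mul, mul_comm]
      congr 2; ring
    · rw [Set.indicator_of_notMem ht, Set.indicator_of_notMem ht, smul_zero]
  rw [mellin]
  simp_rw [e]
  rw [MeasureTheory.setIntegral_indicator measurableSet_Ioi]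
  congr 2
  rw [Set.inter_eq_right]
  exact Set.Ioi_subset_Ioi zero_le_one

theorem differentiableAt_mellin_fractIndicator {s : ℂ} (hs : 0 < s.re) :
    DifferentiableAt ℂ (mellin fractIndicator) (-s) := by
  refine mellin_differentiableAt_of_isBigO_rpow (a := 0) (b := -s.re - 1) ?_ ?_ ?_ ?_ ?_
  · refine MeasureTheory.LocallyIntegrable.locallyIntegrableOn ?_ _
    refine (MeasureTheory.locallyIntegrable_const (1 : ℝ)).mono
      measurable_fractIndicator.aestronglyMeasurable (Filter.Eventually.of_forall fun t => ?_)
    simpa using norm_fractIndicator_le t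
  · refine Asymptotics.IsBigO.of_bound 1 (Filter.Eventually.of_forall fun t => ?_)
    simpa using norm_fractIndicator_le t
  · simpa
  · refine Asymptotics.IsBigO.of_bound 1 ?_
    filter_upwards [Ioo_mem_nhdsGT (zero_lt_one : (0 : ℝ) < 1)] with t ht
    have : fractIndicator t = 0 := Set.indicator_of_notMem (by simp [ht.2.le]) _
    rw [this, norm_zero]
    positivity
  · simp

theorem norm_mellin_fractIndicator_le {s : ℂ} (hs : 0 < s.re) :
    ‖mellin fractIndicator (-s)‖ ≤ 1 / s.re := by
  rw [mellin_fractIndicator]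
  have hInt : MeasureTheory.IntegrableOn (fun t : ℝ => t ^ (-(s.re + 1))) (Set.Ioi 1) :=
    integrableOn_Ioi_rpow_of_lt (by linarith) zero_lt_one
  have hval := integral_Ioi_rpow_of_lt (a := -(s.re + 1)) (by linarith) (zero_lt_one (α := ℝ))
  refine (MeasureTheory.norm_integral_le_of_norm_le hInt ?_).trans (le_of_eq ?_)
  · refine (MeasureTheory.ae_restrict_iff' measurableSet_Ioi).2
      (Filter.Eventually.of_forall fun t ht => ?_)
    have ht0 : (0 : ℝ) < t := zero_lt_one.trans ht
    rw [norm_mul, Complex.norm_real, Real.norm_of_nonneg (Int.fract_nonneg t),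
      Complex.norm_cpow_eq_rpow_re_of_pos ht0]
    have : (-(s + 1)).re = -(s.re + 1) := by simp
    rw [this]
    exact mul_le_of_le_one_left (by positivity) (Int.fract_lt_one t).le
  · rw [hval, Real.one_rpow]
    rw [div_eq_div_iff (by linarith) (by linarith)]
    ring

theorem riemannZeta₁_eq_of_one_lt_re {s : ℂ} (hs : 1 < s.re) :
    riemannZeta₁ s = s - s * (s - 1) * mellin fractIndicator (-s) := by
  have hs1 : s ≠ 1 := fun h => by simp [h] at hs
  have hs0 : s - 1 ≠ 0 := sub_ne_zero.2 hs1
  have hsn : s ≠ 0 := fun h => by simp [h] at hs; linarith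
  have hL := LSeries_eq_mul_integral_of_nonneg (fun _ => 1) (r := 1) zero_le_one hs
    (by
      refine Asymptotics.IsBigO.of_bound 1 (Filter.Eventually.of_forall fun n => ?_)
      simp) (fun _ => zero_le_one)
  have h1 : LSeries (fun _ => ((1 : ℝ) : ℂ)) s = riemannZeta s := by
    rw [← LSeries_one_eq_riemannZeta hs]
    congr 1
  rw [h1] at hL
  have hI1 : MeasureTheory.IntegrableOn (fun t : ℝ => (t : ℂ) ^ (-s)) (Set.Ioi 1) :=
    integrableOn_Ioi_cpow_of_lt (by simpa) zero_lt_one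
  have hI2 : MeasureTheory.IntegrableOn
      (fun t : ℝ => ((Int.fract t : ℝ) : ℂ) * (t : ℂ) ^ (-(s + 1))) (Set.Ioi 1) := by
    have hg : MeasureTheory.IntegrableOn (fun t : ℝ => (t : ℂ) ^ (-(s + 1))) (Set.Ioi 1) :=
      integrableOn_Ioi_cpow_of_lt (by simp; linarith) zero_lt_one
    refine hg.bdd_mul (c := 1) ?_ ?_
    · exact (Complex.measurable_ofReal.comp measurable_fract).aestronglyMeasurable
    · refine Filter.Eventually.of_forall fun t => ?_
      rw [Complex.norm_real, Real.norm_of_nonneg (Int.fract_nonneg t)]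
      exact (Int.fract_lt_one t).le
  have h2 : ∫ t in Set.Ioi (1 : ℝ),
      (∑ k ∈ Finset.Icc 1 ⌊t⌋₊, ((1 : ℝ) : ℂ)) * (t : ℂ) ^ (-(s + 1)) =
      (∫ t in Set.Ioi (1 : ℝ), (t : ℂ) ^ (-s)) - mellin fractIndicator (-s) := by
    rw [mellin_fractIndicator, ← MeasureTheory.integral_sub hI1 hI2]
    refine MeasureTheory.setIntegral_congr_fun measurableSet_Ioi fun t ht => ?_
    have ht0 : (0 : ℝ) < t := zero_lt_one.trans ht
    have e1 : (t : ℂ) ^ (-s) = (t : ℂ) * (t : ℂ) ^ (-(s + 1)) := by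
      rw [show -s = 1 + -(s + 1) by ring,
        Complex.cpow_add _ _ (Complex.ofReal_ne_zero.2 ht0.ne'), Complex.cpow_one]
    have e2 : ((⌊t⌋₊ : ℝ)) = t - Int.fract t := by
      rw [Int.self_sub_fract, natCast_floor_eq_intCast_floor ht0.le]
    have e3 : ((⌊t⌋₊ : ℂ)) = (t : ℂ) - ((Int.fract t : ℝ) : ℂ) := by
      rw [← Complex.ofReal_sub, ← e2]; simp
    simp only [Complex.ofReal_one, Finset.sum_const, Nat.card_Icc, add_tsub_cancel_right,
      nsmul_eq_mul, mul_one]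
    rw [e1, e3]
    ring
  rw [h2, integral_Ioi_cpow_of_lt (by simpa) zero_lt_one] at hL
  rw [riemannZeta_eq_inv_sub_mul hs1] at hL
  have h4 : -s + 1 ≠ 0 := fun h => hs0 (by linear_combination -h)
  simp only [Complex.ofReal_one, Complex.one_cpow] at hL
  field_simp at hL
  have h5 : (-s + 1) * (riemannZeta₁ s - (s - s * (s - 1) * mellin fractIndicator (-s))) = 0 := by
    linear_combination hL
  exact sub_eq_zero.1 ((mul_eq_zero.1 h5).resolve_left h4)

theorem riemannZeta₁_eq_of_re_pos {s : ℂ} (hs : 0 < s.re) :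
    riemannZeta₁ s = s - s * (s - 1) * mellin fractIndicator (-s) := by
  have hopen : IsOpen {z : ℂ | 0 < z.re} := isOpen_lt continuous_const Complex.continuous_re
  have h1 : AnalyticOnNhd ℂ riemannZeta₁ {z : ℂ | 0 < z.re} :=
    differentiable_riemannZeta₁.differentiableOn.analyticOnNhd hopen
  have h2 : AnalyticOnNhd ℂ (fun s => s - s * (s - 1) * mellin fractIndicator (-s))
      {z : ℂ | 0 < z.re} := by
    refine DifferentiableOn.analyticOnNhd (fun z hz => ?_) hopen
    have := (differentiableAt_mellin_fractIndicator hz).comp z differentiableAt_id.neg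
    refine DifferentiableAt.differentiableWithinAt ?_
    have h3 : DifferentiableAt ℂ (fun s => mellin fractIndicator (-s)) z := this
    fun_prop
  refine h1.eqOn_of_preconnected_of_eventuallyEq h2 (convex_halfSpace_re_gt 0).isPreconnected
    (z₀ := 2) (by simp) ?_ hs
  filter_upwards [(isOpen_lt continuous_const Complex.continuous_re).mem_nhds
    (by simp : (1 : ℝ) < (2 : ℂ).re)] with z hz using riemannZeta₁_eq_of_one_lt_re hz

theorem norm_riemannZeta₁_le {s : ℂ} (hs : 0 < s.re) :
    ‖riemannZeta₁ s‖ ≤ ‖s‖ + ‖s‖ * ‖s - 1‖ / s.re := by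
  rw [riemannZeta₁_eq_of_re_pos hs]
  refine (norm_sub_le _ _).trans ?_
  rw [norm_mul, norm_mul, div_eq_mul_one_div]
  gcongr
  exact norm_mellin_fractIndicator_le hs

theorem card_zeros_le_of_norm_le {f : ℂ → ℂ} {c : ℂ} {r R M : ℝ} (hr : 0 < r) (hrR : r < R)
    (hM : 1 ≤ M) (hf : AnalyticOnNhd ℂ f (Metric.closedBall c R)) (hc : f c ≠ 0)
    (hbound : ∀ z ∈ Metric.sphere c R, ‖f z‖ ≤ M) (S : Finset ℂ)
    (hS : ∀ u ∈ S, u ∈ Metric.closedBall c r ∧ f u = 0) :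
    (S.card : ℝ) ≤ Real.log (M / ‖f c‖) / Real.log (R / r) := by
  have hR : 0 < R := hr.trans hrR
  have hJ := AnalyticOnNhd.sum_divisor_le (c := c) (r := r) (R := R) (M := M) (f := f)
    (by positivity) (by rwa [abs_of_pos hr, abs_of_pos hR]) hM (by rwa [abs_of_pos hR]) hc
    (by rwa [abs_of_pos hR])
  rw [abs_of_pos hr] at hJ
  refine le_trans ?_ hJ
  have hfr : AnalyticOnNhd ℂ f (Metric.closedBall c r) :=
    hf.mono (Metric.closedBall_subset_closedBall hrR.le)
  have hfin := (MeromorphicOn.divisor f (Metric.closedBall c r)).finiteSupport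
    (isCompact_closedBall c r)
  have hge : ∀ u ∈ S, 1 ≤ MeromorphicOn.divisor f (Metric.closedBall c r) u := by
    intro u hu
    obtain ⟨hu1, hu2⟩ := hS u hu
    rw [MeromorphicOn.AnalyticOnNhd.divisor_apply hfr hu1]
    have hcc : c ∈ Metric.closedBall c r := Metric.mem_closedBall_self hr.le
    have htop : analyticOrderAt f u ≠ ⊤ := by
      refine hfr.analyticOrderAt_ne_top_of_isPreconnected
        (convex_closedBall c r).isPreconnected hcc hu1 ?_
      rw [(hfr c hcc).analyticOrderAt_eq_zero.2 hc]
      simp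
    have hne : analyticOrderAt f u ≠ 0 := fun h =>
      (hfr u hu1).analyticOrderAt_eq_zero.1 h hu2
    obtain ⟨n, hn⟩ := ENat.ne_top_iff_exists.1 htop
    rw [← hn] at hne ⊢
    have hn0 : n ≠ 0 := fun h => hne (by simp [h])
    simpa using Nat.one_le_iff_ne_zero.2 hn0
  have hsub : S ⊆ hfin.toFinset := fun u hu => by
    have := hge u hu
    simp only [Set.Finite.mem_toFinset, Function.mem_support]
    omega
  have h1 : (S.card : ℤ) ≤ ∑ᶠ u, MeromorphicOn.divisor f (Metric.closedBall c r) u := by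
    rw [finsum_eq_sum_of_support_subset (s := hfin.toFinset) _ (by simp)]
    calc (S.card : ℤ) = ∑ u ∈ S, 1 := by simp
      _ ≤ ∑ u ∈ S, MeromorphicOn.divisor f (Metric.closedBall c r) u := Finset.sum_le_sum hge
      _ ≤ _ := Finset.sum_le_sum_of_subset_of_nonneg hsub fun u _ _ =>
        MeromorphicOn.AnalyticOnNhd.divisor_nonneg hfr u
  exact_mod_cast h1

theorem exists_eq_mul_exp_of_ne_zero {f : ℂ → ℂ} {R : ℝ} (hR : 0 < R)
    (hf : DifferentiableOn ℂ f (Metric.ball 0 R)) (h0 : ∀ z ∈ Metric.ball (0 : ℂ) R, f z ≠ 0) :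
    ∃ h : ℂ → ℂ, DifferentiableOn ℂ h (Metric.ball 0 R) ∧ h 0 = 0 ∧
      ∀ z ∈ Metric.ball (0 : ℂ) R, f z = f 0 * Complex.exp (h z) := by
  have hd : DifferentiableOn ℂ (fun z => deriv f z / f z) (Metric.ball 0 R) :=
    (hf.deriv Metric.isOpen_ball).div hf h0
  obtain ⟨h, hh0, hh⟩ := hd.isExactOn_ball.with_val_at 0 0
  have hmem : (0 : ℂ) ∈ Metric.ball (0 : ℂ) R := Metric.mem_ball_self hR
  refine ⟨h, fun z hz => (hh z hz).differentiableAt.differentiableWithinAt, hh0, fun z hz => ?_⟩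
  have hG : ∀ w ∈ Metric.ball (0 : ℂ) R,
      HasDerivAt (fun w => f w * Complex.exp (-h w)) 0 w := fun w hw => by
    have hfw := (hf.differentiableAt (Metric.isOpen_ball.mem_nhds hw)).hasDerivAt
    have := hfw.mul (hh w hw).neg.cexp
    refine this.congr_deriv ?_
    have := h0 w hw
    field_simp
    simp
  have hconst := Metric.isOpen_ball.is_const_of_deriv_eq_zero
    (convex_ball (0 : ℂ) R).isPreconnected
    (fun w hw => (hG w hw).differentiableAt.differentiableWithinAt)
    (fun w hw => (hG w hw).deriv) hz hmem
  simp only [hh0, neg_zero, Complex.exp_zero, mul_one] at hconst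
  rw [← hconst, mul_assoc, ← Complex.exp_add]
  simp

theorem norm_ge_of_ne_zero_of_norm_le {f : ℂ → ℂ} {c : ℂ} {R M : ℝ} (hR : 0 < R)
    (hf : DifferentiableOn ℂ f (Metric.ball c R)) (h0 : ∀ z ∈ Metric.ball c R, f z ≠ 0)
    (hM : ∀ z ∈ Metric.ball c R, ‖f z‖ ≤ M) (hcM : ‖f c‖ < M) {z : ℂ}
    (hz : z ∈ Metric.ball c R) :
    ‖f c‖ * Real.exp (-(2 * Real.log (M / ‖f c‖) * ‖z - c‖ / (R - ‖z - c‖))) ≤ ‖f z‖ := by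
  have hmaps : ∀ w ∈ Metric.ball (0 : ℂ) R, c + w ∈ Metric.ball c R := fun w hw => by
    simpa using hw
  have hc0 : f c ≠ 0 := h0 c (Metric.mem_ball_self hR)
  have hcpos : 0 < ‖f c‖ := norm_pos_iff.2 hc0
  obtain ⟨h, hd, hh0, hexp⟩ := exists_eq_mul_exp_of_ne_zero (f := fun w => f (c + w)) hR
    (hf.comp (by fun_prop) hmaps) (fun w hw => h0 _ (hmaps w hw))
  simp only [add_zero] at hexp
  have hlog : 0 < Real.log (M / ‖f c‖) := Real.log_pos ((one_lt_div hcpos).2 hcM)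
  have hzb : z - c ∈ Metric.ball (0 : ℂ) R := by
    simpa [dist_eq_norm] using hz
  have hBC := Complex.borelCaratheodory_zero hlog hd (fun w hw => by
    have h1 := hM _ (hmaps w hw)
    rw [hexp w hw, norm_mul, Complex.norm_exp] at h1
    simp only [Set.mem_ofPred_eq]
    rw [Real.le_log_iff_exp_le (div_pos (hcpos.trans hcM) hcpos), le_div_iff₀ hcpos]
    linarith) hR hzb hh0
  have hfz := hexp _ hzb
  rw [add_sub_cancel] at hfz
  rw [hfz, norm_mul, Complex.norm_exp]
  gcongr
  linarith [neg_abs_le (h (z - c)).re, Complex.abs_re_le_norm (h (z - c))]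

theorem norm_riemannZeta₁_le_of_mem_disc {z : ℂ} {y : ℝ} (hz : ‖z - (2 + y * I)‖ ≤ 7 / 4) :
    ‖riemannZeta₁ z‖ ≤ 6 * (|y| + 5) ^ 2 := by
  have hre : 1 / 4 ≤ z.re := by
    have h := (abs_le.1 ((Complex.abs_re_le_norm _).trans hz)).1
    simp at h
    linarith
  have hy : ‖(y : ℂ) * I‖ = |y| := by simp
  have h1 : ‖z‖ ≤ |y| + 5 := by
    have e : z = (z - (2 + y * I)) + 2 + y * I := by ring
    have := norm_add₃_le (a := z - (2 + y * I)) (b := 2) (c := y * I)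
    rw [← e, hy, Complex.norm_two] at this
    linarith
  have h2 : ‖z - 1‖ ≤ |y| + 5 := by
    have e : z - 1 = (z - (2 + y * I)) + 1 + y * I := by ring
    have := norm_add₃_le (a := z - (2 + y * I)) (b := 1) (c := y * I)
    rw [← e, hy, norm_one] at this
    linarith
  have hY : 5 ≤ |y| + 5 := by linarith [abs_nonneg y]
  calc ‖riemannZeta₁ z‖ ≤ ‖z‖ + ‖z‖ * ‖z - 1‖ / z.re := norm_riemannZeta₁_le (by linarith)
    _ ≤ (|y| + 5) + (|y| + 5) * (|y| + 5) / (1 / 4) := by gcongr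
    _ ≤ 6 * (|y| + 5) ^ 2 := by nlinarith

theorem one_quarter_le_norm_riemannZeta₁ (y : ℝ) : 1 / 4 ≤ ‖riemannZeta₁ (2 + y * I)‖ := by
  have h := one_quarter_le_norm_riemannZeta (s := 2 + y * I) (by simp)
  have hne : (2 + y * I : ℂ) - 1 ≠ 0 := fun h => by
    have := congrArg Complex.re h
    norm_num at this
  rw [riemannZeta_eq_inv_sub_mul (sub_ne_zero.1 hne), norm_mul, norm_inv] at h
  have h1 : 1 ≤ ‖(2 + y * I : ℂ) - 1‖ := by
    refine le_trans ?_ (Complex.re_le_norm _)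
    norm_num
  refine h.trans (mul_le_of_le_one_left (norm_nonneg _) (inv_le_one_of_one_le₀ h1))

theorem one_sub_conj_mem_zetaZeros {ρ : ℂ} (h : ρ ∈ zetaZeros) :
    1 - (starRingEnd ℂ) ρ ∈ zetaZeros := by
  obtain ⟨h0, h1, h2⟩ := h
  refine ⟨?_, by simpa using h2, by simpa using h1⟩
  rw [riemannZeta_one_sub, riemannZeta_conj, h0]
  · simp
  · intro n hn
    have := congrArg Complex.re hn
    simp at this
    linarith [(n.cast_nonneg : (0 : ℝ) ≤ n)]
  · intro hn
    have := congrArg Complex.re hn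
    simp at this
    linarith

theorem riemannZeta₁_eq_zero_of_mem {ρ : ℂ} (h : ρ ∈ zetaZeros) : riemannZeta₁ ρ = 0 := by
  have hne : ρ ≠ 1 := fun e => by
    have := h.2.2
    simp [e] at this
  have h0 := h.1
  rw [riemannZeta_eq_inv_sub_mul hne] at h0
  exact (mul_eq_zero.1 h0).resolve_left (inv_ne_zero (sub_ne_zero.2 hne))

theorem card_right_zeros_le (k : ℕ) (S : Finset ℂ)
    (hS : ∀ ρ ∈ S, ρ ∈ zetaZeros ∧ 1 / 2 ≤ ρ.re ∧ k ≤ ρ.im ∧ ρ.im ≤ k + 1) :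
    (S.card : ℝ) ≤ 4 / Real.log (14 / 13) * Real.log (k + 6) := by
  have hk : (0 : ℝ) ≤ k := k.cast_nonneg
  set y : ℝ := k + 1 / 2 with hy
  have hy0 : |y| = y := abs_of_nonneg (by positivity)
  have hq := one_quarter_le_norm_riemannZeta₁ y
  have hlog : 0 < Real.log (14 / 13) := Real.log_pos (by norm_num)
  have key := card_zeros_le_of_norm_le (f := riemannZeta₁) (c := 2 + y * I) (r := 13 / 8)
    (R := 7 / 4) (M := 6 * (|y| + 5) ^ 2) (by norm_num) (by norm_num)
    (by nlinarith [abs_nonneg y])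
    (fun z _ => differentiable_riemannZeta₁.analyticAt z)
    (fun h => by rw [h, norm_zero] at hq; norm_num at hq)
    (fun z hz => norm_riemannZeta₁_le_of_mem_disc (by
      rw [mem_sphere_iff_norm] at hz
      exact hz.le)) S
    (fun ρ hρ => by
      obtain ⟨h1, h2, h3, h4⟩ := hS ρ hρ
      refine ⟨?_, riemannZeta₁_eq_zero_of_mem h1⟩
      have h5 := h1.2.2
      rw [mem_closedBall_iff_norm, Complex.norm_def,
        Real.sqrt_le_left (by norm_num), Complex.normSq_apply]
      simp only [sub_re, add_re, re_ofNat, mul_re, ofReal_re, I_re, mul_zero, ofReal_im, I_im,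
        mul_one, sub_self, add_zero, sub_im, add_im, im_ofNat, mul_im, zero_add]
      nlinarith)
  refine key.trans ?_
  rw [show (7 / 4 / (13 / 8) : ℝ) = 14 / 13 by norm_num, div_mul_eq_mul_div]
  gcongr
  have h6 : Real.log ((k + 6) ^ 4) = 4 * Real.log (k + 6 : ℝ) := by
    rw [Real.log_pow]; norm_num
  rw [← h6]
  refine Real.log_le_log (by positivity) ?_
  rw [div_le_iff₀ (by linarith)]
  calc 6 * (|y| + 5) ^ 2 ≤ 6 * (k + 6) ^ 2 := by
        rw [hy0, hy]
        gcongr 6 * ?_ ^ 2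
        linarith
    _ ≤ (k + 6 : ℝ) ^ 4 * (1 / 4) := by nlinarith [pow_nonneg hk 2, pow_nonneg hk 3]
    _ ≤ _ := by gcongr

theorem card_zeros_le (k : ℕ) (S : Finset ℂ)
    (hS : ∀ ρ ∈ S, ρ ∈ zetaZeros ∧ k ≤ ρ.im ∧ ρ.im ≤ k + 1) :
    (S.card : ℝ) ≤ 8 / Real.log (14 / 13) * Real.log (k + 6) := by
  classical
  have h1 := card_right_zeros_le k (S.filter fun ρ => 1 / 2 ≤ ρ.re) fun ρ hρ => by
    rw [Finset.mem_filter] at hρ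
    obtain ⟨a, b, c⟩ := hS ρ hρ.1
    exact ⟨a, hρ.2, b, c⟩
  have h2 := card_right_zeros_le k
    ((S.filter fun ρ => ¬ 1 / 2 ≤ ρ.re).image fun ρ => 1 - (starRingEnd ℂ) ρ) fun ρ' hρ' => by
      obtain ⟨ρ, hρ, rfl⟩ := Finset.mem_image.1 hρ'
      rw [Finset.mem_filter] at hρ
      obtain ⟨a, b, c⟩ := hS ρ hρ.1
      refine ⟨one_sub_conj_mem_zetaZeros a, ?_, by simpa using b, by simpa using c⟩
      simp
      linarith [hρ.2]
  rw [Finset.card_image_of_injective] at h2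
  · rw [← Finset.card_filter_add_card_filter_not (fun ρ : ℂ => 1 / 2 ≤ ρ.re)]
    push_cast
    calc _ ≤ _ := add_le_add h1 h2
      _ = _ := by ring
  · intro a b hab
    exact (starRingEnd ℂ).injective (sub_right_injective hab)

theorem summable_floor_im_rpow {p : ℝ} (hp : 1 < p) :
    Summable fun ρ : upperZeros => ((⌊(ρ : ℂ).im⌋₊ : ℝ) + 1) ^ (-p) := by
  let φ : upperZeros → ℕ := fun ρ => ⌊(ρ : ℂ).im⌋₊
  have hcard (k : ℕ) (T : Finset {ρ : upperZeros // φ ρ = k}) :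
      (T.card : ℝ) ≤ 8 / Real.log (14 / 13) * Real.log (k + 6) := by
    have := card_zeros_le k (T.map ⟨fun ρ : {ρ : upperZeros // φ ρ = k} => ((ρ : upperZeros) : ℂ), fun a b h =>
      Subtype.ext (Subtype.ext (by exact h))⟩) fun ρ hρ => by
        obtain ⟨ρ, _, rfl⟩ := Finset.mem_map.1 hρ
        have h1 := (ρ : upperZeros).2
        have h2 : ⌊((ρ : upperZeros) : ℂ).im⌋₊ = k := ρ.2
        have h3 := Nat.floor_le h1.2.le
        have h4 := (Nat.lt_floor_add_one ((ρ : upperZeros) : ℂ).im).le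
        rw [h2] at h3 h4
        exact ⟨h1.1, h3, h4⟩
    rwa [Finset.card_map] at this
  have hfin (k : ℕ) : Finite {ρ : upperZeros // φ ρ = k} := by
    by_contra h
    rw [not_finite_iff_infinite] at h
    obtain ⟨n, hn⟩ := exists_nat_gt (8 / Real.log (14 / 13) * Real.log (k + 6))
    obtain ⟨T, hT⟩ := Infinite.exists_subset_card_eq {ρ : upperZeros // φ ρ = k} n
    have := hcard k T
    rw [hT] at this
    linarith
  have hnonneg : ∀ x : Σ k, {ρ : upperZeros // φ ρ = k},
      0 ≤ ((fun ρ : upperZeros => ((⌊(ρ : ℂ).im⌋₊ : ℝ) + 1) ^ (-p)) ∘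
        Equiv.sigmaFiberEquiv φ) x := fun x => by
    simp only [Function.comp_apply]
    positivity
  rw [← (Equiv.sigmaFiberEquiv φ).summable_iff, summable_sigma_of_nonneg hnonneg]
  refine ⟨fun k => Summable.of_finite, ?_⟩
  set ε : ℝ := (p - 1) / 2 with hε
  have hε0 : 0 < ε := by rw [hε]; linarith
  have hlog : 0 < Real.log (14 / 13) := Real.log_pos (by norm_num)
  have hs : Summable fun k : ℕ => ((k : ℝ) + 1) ^ (-p + ε) := by
    have := (summable_nat_add_iff 1).2
      (Real.summable_nat_rpow (p := -p + ε).2 (by rw [hε]; linarith))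
    simpa using this
  refine Summable.of_nonneg_of_le (fun k => tsum_nonneg fun x => hnonneg ⟨k, x⟩) (fun k => ?_)
    (hs.mul_left (8 / Real.log (14 / 13) * (6 ^ ε / ε)))
  have := Fintype.ofFinite {ρ : upperZeros // φ ρ = k}
  have hk : (0 : ℝ) ≤ k := k.cast_nonneg
  have hval : ∀ x : {ρ : upperZeros // φ ρ = k},
      ((fun ρ : upperZeros => ((⌊(ρ : ℂ).im⌋₊ : ℝ) + 1) ^ (-p)) ∘
        Equiv.sigmaFiberEquiv φ) ⟨k, x⟩ = ((k : ℝ) + 1) ^ (-p) := fun x => by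
    simp only [Function.comp_apply, Equiv.sigmaFiberEquiv_apply]
    rw [show ⌊((x : upperZeros) : ℂ).im⌋₊ = k from x.2]
  rw [tsum_fintype, Finset.sum_congr rfl fun x _ => hval x, Finset.sum_const, nsmul_eq_mul]
  calc ((Finset.univ : Finset {ρ : upperZeros // φ ρ = k}).card : ℝ) * ((k : ℝ) + 1) ^ (-p)
      ≤ 8 / Real.log (14 / 13) * ((6 * (k + 1)) ^ ε / ε) * ((k : ℝ) + 1) ^ (-p) := by
        gcongr
        refine (hcard k _).trans ?_
        gcongr
        refine (Real.log_le_rpow_div (by positivity) hε0).trans ?_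
        gcongr
        linarith
    _ = _ := by
        rw [Real.mul_rpow (by norm_num) (by positivity), Real.rpow_add (by positivity)]
        ring

theorem finite_upperZeros_im_le (B : ℝ) : {ρ : upperZeros | (ρ : ℂ).im ≤ B}.Finite := by
  have h := (IsCompact.inter_riemannZetaZeros_finite
    (isCompact_Icc.reProdIm isCompact_Icc : IsCompact (Set.Icc (0 : ℝ) 1 ×ℂ Set.Icc (0 : ℝ) B)))
  refine Set.Finite.of_finite_image (h.subset ?_) Subtype.val_injective.injOn
  rintro _ ⟨ρ, hρ, rfl⟩
  obtain ⟨⟨h0, h1, h2⟩, h3⟩ := ρ.2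
  exact ⟨⟨⟨h1.le, h2.le⟩, ⟨h3.le, hρ⟩⟩, h0⟩

theorem summable_im_rpow {p : ℝ} (hp : 1 < p) :
    Summable fun ρ : upperZeros => (ρ : ℂ).im ^ (-p) := by
  refine ((summable_floor_im_rpow hp).mul_left (2 ^ p)).of_norm_bounded_eventually ?_
  rw [Filter.eventually_cofinite]
  refine (finite_upperZeros_im_le 1).subset fun ρ hρ => ?_
  by_contra h1
  simp only [Set.mem_ofPred_eq, not_le] at h1 hρ
  refine hρ.not_ge ?_
  have hpos : 0 < (ρ : ℂ).im := ρ.2.2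
  rw [Real.norm_of_nonneg (by positivity)]
  have hfl : ((⌊(ρ : ℂ).im⌋₊ : ℝ) + 1) ≤ 2 * (ρ : ℂ).im := by
    have := Nat.floor_le hpos.le
    linarith
  calc (ρ : ℂ).im ^ (-p) = 2 ^ p * (2 * (ρ : ℂ).im) ^ (-p) := by
        rw [Real.mul_rpow (by norm_num) hpos.le, ← mul_assoc, ← Real.rpow_add (by norm_num)]
        simp
    _ ≤ 2 ^ p * ((⌊(ρ : ℂ).im⌋₊ : ℝ) + 1) ^ (-p) := by
        gcongr 2 ^ p * ?_
        exact Real.rpow_le_rpow_of_nonpos (by positivity) hfl (by linarith)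

theorem arctan_le_self {t : ℝ} (ht : 0 ≤ t) : Real.arctan t ≤ t := by
  have := Real.le_tan (Real.arctan_nonneg.2 ht) (Real.arctan_lt_pi_div_two t)
  rwa [Real.tan_arctan] at this

theorem half_le_arctan {t : ℝ} (h0 : 0 ≤ t) (h1 : t ≤ 1) : t / 2 ≤ Real.arctan t := by
  have h := Real.sin_le (Real.arctan_nonneg.2 h0)
  rw [Real.sin_arctan] at h
  refine le_trans ?_ h
  gcongr
  rw [Real.sqrt_le_left (by norm_num)]
  nlinarith

theorem exp_neg_le_rpow (n : ℕ) {x A : ℝ} (hx : 0 < x) (hA : 0 ≤ A) (hAn : A ≤ n) :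
    Real.exp (-x) ≤ (1 + n.factorial) * x ^ (-A) := by
  have h1 : x ^ A ≤ 1 + x ^ n := by
    rcases le_total x 1 with h | h
    · exact (Real.rpow_le_one hx.le h hA).trans (by linarith [pow_nonneg hx.le n])
    · have := Real.rpow_le_rpow_of_exponent_le h hAn
      rw [Real.rpow_natCast] at this
      linarith
  have h2 := Real.pow_div_factorial_le_exp x hx.le n
  rw [div_le_iff₀ (by positivity)] at h2
  have h3 := Real.one_le_exp hx.le
  rw [Real.exp_neg, Real.rpow_neg hx.le, ← div_eq_mul_inv, le_div_iff₀ (by positivity),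
    inv_mul_le_iff₀ (Real.exp_pos x)]
  linarith

theorem exists_integrand_le {α c : ℝ} (hc : 0 ≤ c) {ε : ℝ} (hε : 0 < ε)
    (hεα : ε ≤ α - 1) : ∃ C : ℝ, 0 ≤ C ∧ ∀ β γ u : ℝ, 0 < β → β < 1 → 0 < γ → 1 < u →
      Real.exp (-γ * Real.arctan (1 / u)) * u ^ (-α - β) * Real.log u ^ c ≤
        C * γ ^ (-(α + β - 1 - ε)) * u ^ (-1 - ε / 2) := by
  set δ : ℝ := ε / (2 * (c + 1)) with hδ
  have hδ0 : 0 < δ := by positivity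
  have hδc : δ * c ≤ ε / 2 := by
    rw [hδ, div_mul_eq_mul_div, div_le_div_iff₀ (by positivity) (by positivity)]
    nlinarith
  refine ⟨(1 + ⌈α⌉₊.factorial) * 2 ^ α * δ ^ (-c), by positivity, fun β γ u h0 h1 hγ hu => ?_⟩
  have hu0 : 0 < u := by linarith
  set A : ℝ := α + β - 1 - ε with hA
  have hA0 : 0 ≤ A := by rw [hA]; linarith
  have hAα : A ≤ α := by rw [hA]; linarith
  have e1 : Real.exp (-γ * Real.arctan (1 / u)) ≤
      (1 + ⌈α⌉₊.factorial) * (2 ^ α * γ ^ (-A) * u ^ A) := by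
    have h2 := half_le_arctan (t := 1 / u) (by positivity) (by rw [div_le_one hu0]; exact hu.le)
    calc Real.exp (-γ * Real.arctan (1 / u)) ≤ Real.exp (-(γ * (1 / u / 2))) := by
          rw [neg_mul]; gcongr
      _ ≤ (1 + ⌈α⌉₊.factorial) * (γ * (1 / u / 2)) ^ (-A) :=
          exp_neg_le_rpow _ (by positivity) hA0 (hAα.trans (Nat.le_ceil α))
      _ = (1 + ⌈α⌉₊.factorial) * (2 ^ A * γ ^ (-A) * u ^ A) := by
          rw [Real.mul_rpow hγ.le (by positivity), Real.div_rpow (by positivity) (by norm_num),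
            Real.div_rpow (by norm_num) hu0.le, Real.one_rpow, Real.rpow_neg hu0.le,
            Real.rpow_neg (by norm_num : (0 : ℝ) ≤ 2)]
          field_simp
      _ ≤ _ := by gcongr; norm_num
  have e2 : Real.log u ^ c ≤ δ ^ (-c) * u ^ (ε / 2) := by
    calc Real.log u ^ c ≤ (u ^ δ / δ) ^ c := by
          gcongr
          · exact Real.log_nonneg hu.le
          · exact Real.log_le_rpow_div hu0.le hδ0
      _ = δ ^ (-c) * u ^ (δ * c) := by
          rw [Real.div_rpow (by positivity) hδ0.le, ← Real.rpow_mul hu0.le,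
            Real.rpow_neg hδ0.le, div_eq_inv_mul]
      _ ≤ _ := by gcongr; exact hu.le
  calc Real.exp (-γ * Real.arctan (1 / u)) * u ^ (-α - β) * Real.log u ^ c
      ≤ (1 + ⌈α⌉₊.factorial) * (2 ^ α * γ ^ (-A) * u ^ A) * u ^ (-α - β) *
        (δ ^ (-c) * u ^ (ε / 2)) := by
        gcongr
        exact Real.rpow_nonneg (Real.log_nonneg hu.le) c
    _ = (1 + ⌈α⌉₊.factorial) * 2 ^ α * δ ^ (-c) * γ ^ (-A) *
        (u ^ A * u ^ (-α - β) * u ^ (ε / 2)) := by ring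
    _ = _ := by
        rw [← Real.rpow_add hu0, ← Real.rpow_add hu0]
        congr 2
        rw [hA]; ring

theorem summable_zero_series {α c : ℝ} (hα : 3 / 2 < α) (hc : 0 ≤ c) :
    Summable (fun ρ : upperZeros =>
      (ρ : ℂ).im ^ ((ρ : ℂ).re - 1 / 2) *
        ∫ u in Set.Ioi (1 : ℝ),
          Real.exp (-(ρ : ℂ).im * Real.arctan (1 / u)) * u ^ (-α - (ρ : ℂ).re) *
            Real.log u ^ c) := by
  set ε : ℝ := (α - 3 / 2) / 2 with hε
  have hε0 : 0 < ε := by rw [hε]; linarith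
  obtain ⟨C, hC, hle⟩ := exists_integrand_le (α := α) hc hε0 (by rw [hε]; linarith)
  have hInt : MeasureTheory.IntegrableOn (fun u : ℝ => u ^ (-1 - ε / 2)) (Set.Ioi 1) :=
    integrableOn_Ioi_rpow_of_lt (by linarith) one_pos
  have hnn (ρ : upperZeros) : ∀ u ∈ Set.Ioi (1 : ℝ),
      0 ≤ Real.exp (-(ρ : ℂ).im * Real.arctan (1 / u)) * u ^ (-α - (ρ : ℂ).re) *
            Real.log u ^ c := fun u hu => by
    have hu1 : (1 : ℝ) < u := hu
    have := Real.rpow_nonneg (Real.log_nonneg hu1.le) c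
    have : 0 < u := by linarith
    positivity
  refine Summable.of_nonneg_of_le (fun ρ => ?_) (fun ρ => ?_)
    ((summable_im_rpow (p := α - 1 / 2 - ε) (by rw [hε]; linarith)).mul_left
      (C * ∫ u in Set.Ioi (1 : ℝ), u ^ (-1 - ε / 2)))
  · exact mul_nonneg (Real.rpow_nonneg ρ.2.2.le _)
      (MeasureTheory.setIntegral_nonneg measurableSet_Ioi (hnn ρ))
  · obtain ⟨⟨-, h0, h1⟩, hγ⟩ := ρ.2
    have key := MeasureTheory.integral_mono_of_nonneg (μ := MeasureTheory.volume.restrict (Set.Ioi 1))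
      ((MeasureTheory.ae_restrict_iff' measurableSet_Ioi).2 (Filter.Eventually.of_forall (hnn ρ)))
      (hInt.const_mul (C * (ρ : ℂ).im ^ (-(α + (ρ : ℂ).re - 1 - ε))))
      ((MeasureTheory.ae_restrict_iff' measurableSet_Ioi).2
        (Filter.Eventually.of_forall fun u hu => hle _ _ u h0 h1 hγ hu))
    rw [MeasureTheory.integral_const_mul] at key
    calc _ ≤ (ρ : ℂ).im ^ ((ρ : ℂ).re - 1 / 2) * (C * (ρ : ℂ).im ^ (-(α + (ρ : ℂ).re - 1 - ε)) *
          ∫ u in Set.Ioi (1 : ℝ), u ^ (-1 - ε / 2)) := by gcongr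
      _ = (C * ∫ u in Set.Ioi (1 : ℝ), u ^ (-1 - ε / 2)) *
          ((ρ : ℂ).im ^ ((ρ : ℂ).re - 1 / 2) *
            (ρ : ℂ).im ^ (-(α + (ρ : ℂ).re - 1 - ε))) := by ring
      _ = _ := by
        rw [← Real.rpow_add hγ]
        congr 2
        ring

theorem riemannZeta₁_ne_zero_of_dist {y : ℝ} (h : ∀ ρ ∈ zetaZeros, 2 ≤ |ρ.im - y|) {z : ℂ}
    (hz : z ∈ Metric.ball (2 + y * I : ℂ) (7 / 4)) : riemannZeta₁ z ≠ 0 := by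
  intro h0
  have hz1 : z ≠ 1 := fun e => by simp [e] at h0
  have hζ : riemannZeta z = 0 := by rw [riemannZeta_eq_inv_sub_mul hz1, h0, mul_zero]
  have hlt : z.re < 1 := by
    by_contra! hge
    exact riemannZeta_ne_zero_of_one_le_re hge hζ
  rw [mem_ball_iff_norm] at hz
  have hre := (abs_le.1 ((Complex.abs_re_le_norm _).trans hz.le)).1
  have him := (Complex.abs_im_le_norm _).trans_lt hz
  simp only [sub_re, add_re, re_ofNat, mul_re, ofReal_re, I_re, mul_zero, ofReal_im, I_im,
    mul_one, sub_self, add_zero, sub_im, add_im, im_ofNat, mul_im, zero_add] at hre him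
  linarith [h z ⟨hζ, by linarith, hlt⟩]

theorem exists_norm_zeta_ge_of_half_le_re : ∃ c : ℝ, 0 < c ∧ ∀ w : ℂ, 1 / 2 ≤ w.re → 1 ≤ w.im →
    (∀ ρ ∈ zetaZeros, 2 ≤ |ρ.im - w.im|) → c ≤ ‖riemannZeta w‖ * (w.im + 5) ^ 25 := by
  refine ⟨(1 / 4) ^ 13 / 7 ^ 12, by positivity, fun w hre him hw => ?_⟩
  have hY : 1 ≤ w.im + 5 := by linarith
  have hpow : ∀ n : ℕ, 1 ≤ (w.im + 5) ^ n := fun n => one_le_pow₀ hY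
  rcases le_total 2 w.re with h2 | h2
  · calc ((1 / 4) ^ 13 / 7 ^ 12 : ℝ) ≤ 1 / 4 * 1 := by norm_num
      _ ≤ _ := by
        gcongr
        · exact one_quarter_le_norm_riemannZeta h2
        · exact hpow 25
  have hw1 : w ≠ 1 := fun e => by
    simp [e] at him
    linarith
  set y := w.im with hy
  have hyabs : |y| = y := abs_of_nonneg (by linarith)
  set a : ℝ := ‖riemannZeta₁ (2 + y * I)‖ with ha
  have ha4 : 1 / 4 ≤ a := one_quarter_le_norm_riemannZeta₁ y
  have hbound : ∀ z ∈ Metric.ball (2 + y * I : ℂ) (7 / 4),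
      ‖riemannZeta₁ z‖ ≤ 6 * (y + 5) ^ 2 := fun z hz => by
    rw [mem_ball_iff_norm] at hz
    have := norm_riemannZeta₁_le_of_mem_disc hz.le
    rwa [hyabs] at this
  have haM : a < 7 * (y + 5) ^ 2 := by
    have := hbound _ (Metric.mem_ball_self (by norm_num))
    rw [← ha] at this
    linarith [hpow 2]
  have hwc : ‖w - (2 + y * I)‖ = 2 - w.re := by
    have : w - (2 + y * I) = ((w.re - 2 : ℝ) : ℂ) := by
      apply Complex.ext <;> simp [hy]
    rw [this, Complex.norm_real, Real.norm_eq_abs, abs_of_nonpos (by linarith)]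
    ring
  have key := norm_ge_of_ne_zero_of_norm_le (f := riemannZeta₁) (c := 2 + y * I) (R := 7 / 4)
    (M := 7 * (y + 5) ^ 2) (by norm_num) differentiable_riemannZeta₁.differentiableOn
    (fun z hz => riemannZeta₁_ne_zero_of_dist hw hz)
    (fun z hz => (hbound z hz).trans (by linarith [hpow 2])) haM
    (z := w) (by rw [mem_ball_iff_norm, hwc]; linarith)
  rw [← ha, hwc] at key
  have hlog : 0 < Real.log (7 * (y + 5) ^ 2 / a) :=
    Real.log_pos ((one_lt_div (by linarith)).2 haM)
  have hexp : (a / (7 * (y + 5) ^ 2)) ^ 12 ≤ Real.exp (-(2 * Real.log (7 * (y + 5) ^ 2 / a) *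
      (2 - w.re) / (7 / 4 - (2 - w.re)))) := by
    have : (a / (7 * (y + 5) ^ 2)) ^ 12 = Real.exp (-(12 * Real.log (7 * (y + 5) ^ 2 / a))) := by
      rw [← inv_div, ← Real.exp_log (show 0 < 7 * (y + 5) ^ 2 / a by positivity),
        ← Real.exp_neg, ← Real.exp_nat_mul, Real.log_exp]
      congr 1
      push_cast
      ring
    rw [this]
    gcongr
    rw [div_le_iff₀ (by linarith)]
    nlinarith
  have hζ : ‖riemannZeta₁ w‖ ≤ ‖riemannZeta w‖ * (y + 5) := by
    have e : riemannZeta₁ w = (w - 1) * riemannZeta w := by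
      rw [riemannZeta_eq_inv_sub_mul hw1, ← mul_assoc, mul_inv_cancel₀ (sub_ne_zero.2 hw1),
        one_mul]
    rw [e, norm_mul, mul_comm]
    gcongr
    have := Complex.norm_le_abs_re_add_abs_im (w - 1)
    simp only [sub_re, one_re, sub_im, one_im, sub_zero, ← hy, hyabs] at this
    have h3 : |w.re - 1| ≤ 1 := abs_le.2 ⟨by linarith, by linarith⟩
    linarith
  calc ((1 / 4) ^ 13 / 7 ^ 12 : ℝ) ≤ a ^ 13 / 7 ^ 12 := by gcongr
    _ = a * (a / (7 * (y + 5) ^ 2)) ^ 12 * (y + 5) ^ 24 := by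
      field_simp
    _ ≤ ‖riemannZeta w‖ * (y + 5) * (y + 5) ^ 24 := by
      gcongr ?_ * _
      exact (mul_le_mul_of_nonneg_left hexp (norm_nonneg _)).trans (key.trans hζ)
    _ = _ := by ring

theorem exists_norm_zeta_ge : ∃ c : ℝ, 0 < c ∧ ∀ s : ℂ, 1 ≤ s.im →
    (∀ ρ ∈ zetaZeros, 2 ≤ |ρ.im - s.im|) →
    c * (2 * Real.pi) ^ (-(1 + |s.re - 1 / 2|)) * s.im ^ (max (1 / 2 - s.re) 0 - 1) ≤
      ‖riemannZeta s‖ * (s.im + 5) ^ 25 := by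
  obtain ⟨c₁, hc₁, h₁⟩ := exists_norm_zeta_ge_of_half_le_re
  obtain ⟨c₂, hc₂, h₂⟩ := exists_norm_zeta_one_sub_ge
  have h2pi : 1 ≤ 2 * Real.pi := by linarith [Real.pi_gt_three]
  refine ⟨min c₁ (c₁ * c₂), by positivity, fun s him hs => ?_⟩
  rcases le_total (1 / 2) s.re with h | h
  · refine le_trans ?_ (h₁ s h him hs)
    rw [max_eq_right (by linarith)]
    calc min c₁ (c₁ * c₂) * (2 * Real.pi) ^ (-(1 + |s.re - 1 / 2|)) * s.im ^ (0 - 1 : ℝ)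
        ≤ c₁ * 1 * 1 := by
          gcongr
          · exact min_le_left _ _
          · exact Real.rpow_le_one_of_one_le_of_nonpos h2pi
              (by linarith [abs_nonneg (s.re - 1 / 2)])
          · exact Real.rpow_le_one_of_one_le_of_nonpos him (by norm_num)
      _ = c₁ := by ring
  · set w : ℂ := 1 - (starRingEnd ℂ) s with hw
    have hwre : w.re = 1 - s.re := by simp [hw]
    have hwim : w.im = s.im := by simp [hw]
    have k1 := h₁ w (by rw [hwre]; linarith) (by rwa [hwim]) (by rwa [hwim])
    have k2 := h₂ w (by rw [hwre]; linarith) (by rwa [hwim])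
    have e : ‖riemannZeta (1 - w)‖ = ‖riemannZeta s‖ := by
      rw [hw, sub_sub_cancel, riemannZeta_conj, Complex.norm_conj]
    rw [e, hwim] at k2
    rw [hwim] at k1
    rw [show w.re - 3 / 2 = 1 / 2 - s.re - 1 by rw [hwre]; ring] at k2
    rw [max_eq_left (by linarith), abs_of_nonpos (by linarith)]
    calc min c₁ (c₁ * c₂) * (2 * Real.pi) ^ (-(1 + -(s.re - 1 / 2))) *
          s.im ^ (1 / 2 - s.re - 1)
        ≤ c₁ * c₂ * (2 * Real.pi) ^ (-w.re) * s.im ^ (1 / 2 - s.re - 1) := by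
          gcongr
          · exact min_le_right _ _
          · rw [hwre]; linarith
      _ ≤ (‖riemannZeta w‖ * (s.im + 5) ^ 25) * c₂ * (2 * Real.pi) ^ (-w.re) *
          s.im ^ (1 / 2 - s.re - 1) := by gcongr
      _ = c₂ * (2 * Real.pi) ^ (-w.re) * s.im ^ (1 / 2 - s.re - 1) * ‖riemannZeta w‖ *
          (s.im + 5) ^ 25 := by ring
      _ ≤ _ := by gcongr

theorem exists_norm_zeta_ge_of_dist_le {D : ℝ} (hD : 1 ≤ D) : ∃ c : ℝ, 0 < c ∧ ∀ T : ℝ,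
    2 * D + 5 ≤ T → (∀ ρ ∈ zetaZeros, D + 2 ≤ |ρ.im - T|) → ∀ s : ℂ, |s.re - 1 / 2| ≤ D →
    |s.im - T| ≤ D → c * T ^ (max (1 / 2 - s.re) 0 - 26) ≤ ‖riemannZeta s‖ := by
  obtain ⟨c, hc, h⟩ := exists_norm_zeta_ge
  have h2pi : 1 ≤ 2 * Real.pi := by linarith [Real.pi_gt_three]
  refine ⟨c * (2 * Real.pi) ^ (-(1 + D)) * (2 ^ (-D) / 2) / 3 ^ 25, by positivity,
    fun T hT hgap s hre him => ?_⟩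
  obtain ⟨him1, him2⟩ := abs_le.1 him
  have hT0 : 0 < T := by linarith
  have ht0 : 0 < s.im := by linarith
  have key := h s (by linarith) fun ρ hρ => by
    have := abs_sub_le ρ.im s.im T
    linarith [hgap ρ hρ]
  set m : ℝ := max (1 / 2 - s.re) 0 with hm
  have hm0 : 0 ≤ m := le_max_right _ _
  have hmD : m ≤ D := max_le (by linarith [(abs_le.1 hre).1]) (by linarith)
  have e1 : T ^ m * T⁻¹ * (2 ^ (-D) / 2) ≤ s.im ^ (m - 1) := by
    calc T ^ m * T⁻¹ * (2 ^ (-D) / 2) ≤ T ^ m * T⁻¹ * (2 ^ (-m) / 2) := by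
          gcongr
          norm_num
      _ = (T / 2) ^ m * (2 * T)⁻¹ := by
          rw [Real.div_rpow hT0.le (by norm_num), Real.rpow_neg (by norm_num)]
          field_simp
      _ ≤ s.im ^ m * (s.im)⁻¹ := by
          gcongr <;> linarith
      _ = _ := by rw [Real.rpow_sub ht0, Real.rpow_one, div_eq_mul_inv]
  have e2 : (s.im + 5) ^ 25 ≤ 3 ^ 25 * T ^ 25 := by
    rw [← mul_pow]
    gcongr
    linarith
  have e3 : T ^ (m - 26) = T ^ m * T⁻¹ / T ^ 25 := by
    rw [Real.rpow_sub hT0, show (26 : ℝ) = ((26 : ℕ) : ℝ) by norm_num, Real.rpow_natCast]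
    field_simp
  have hfin : c * (2 * Real.pi) ^ (-(1 + D)) * (T ^ m * T⁻¹ * (2 ^ (-D) / 2)) ≤
      ‖riemannZeta s‖ * (3 ^ 25 * T ^ 25) := by
    calc _ ≤ c * (2 * Real.pi) ^ (-(1 + |s.re - 1 / 2|)) * s.im ^ (m - 1) := by
          gcongr
      _ ≤ _ := key
      _ ≤ _ := by gcongr
  rw [← div_le_iff₀ (by positivity)] at hfin
  refine le_trans (le_of_eq ?_) hfin
  rw [e3]
  field_simp

theorem exists_zetaZero_near : ∃ T₀ R : ℝ, 0 < R ∧ ∀ T : ℝ, T₀ ≤ T →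
    ∃ ρ ∈ zetaZeros, |ρ.im - T| ≤ R := by
  set D : ℝ := 200 with hD
  obtain ⟨c, hc, hlow⟩ := exists_norm_zeta_ge_of_dist_le (D := D) (by norm_num [hD])
  refine ⟨max (2 * D + 5) (24 / c + 1), D + 2, by norm_num [hD], fun T hT => ?_⟩
  by_contra! hno
  have hT1 : 2 * D + 5 ≤ T := (le_max_left _ _).trans hT
  have hT2 : 24 / c + 1 ≤ T := (le_max_right _ _).trans hT
  have hT5 : 5 ≤ T := by linarith
  have hT0 : 0 < T := by linarith
  replace hlow := hlow T hT1 fun ρ hρ => (hno ρ hρ).le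
  set c₀ : ℂ := 1 / 2 + T * I with hc₀
  have hcre : c₀.re = 1 / 2 := by simp [hc₀]
  have hcim : c₀.im = T := by simp [hc₀]
  have hDpos : 0 < D := by norm_num [hD]
  have hball : ∀ s ∈ Metric.closedBall c₀ D,
      c * T ^ (max (1 / 2 - s.re) 0 - 26) ≤ ‖riemannZeta s‖ ∧ s ≠ 1 := fun s hs => by
    rw [mem_closedBall_iff_norm] at hs
    have h1 := (Complex.abs_re_le_norm _).trans hs
    have h2 := (Complex.abs_im_le_norm _).trans hs
    rw [sub_re, hcre] at h1
    rw [sub_im, hcim] at h2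
    refine ⟨hlow s h1 h2, fun e => ?_⟩
    rw [e, one_im] at h2
    linarith [(abs_le.1 h2).1]
  have hζ0 : ∀ s ∈ Metric.closedBall c₀ D, riemannZeta s ≠ 0 := fun s hs h0 => by
    have h1 := (hball s hs).1
    rw [h0, norm_zero] at h1
    have : 0 < c * T ^ (max (1 / 2 - s.re) 0 - 26) := by positivity
    linarith
  let h : ℂ → ℂ := fun s => (riemannZeta s)⁻¹ *
    Complex.exp (Real.log T * ((s - c₀) ^ 2 / (4 * D) - (s - c₀) / 2))
  have hdiff : DifferentiableOn ℂ h (Metric.closedBall c₀ D) := fun s hs => by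
    have h1 := (differentiableAt_riemannZeta (hball s hs).2).inv (hζ0 s hs)
    exact (h1.mul (by fun_prop)).differentiableWithinAt
  have hmax := Complex.norm_le_of_forall_mem_frontier_norm_le (f := h) (z := c₀)
    (U := Metric.ball c₀ D) (C := c⁻¹ * T ^ (-24 : ℝ)) Metric.isBounded_ball
    (hdiff.diffContOnCl_ball subset_rfl) (fun s hs => by
      rw [frontier_ball _ hDpos.ne'] at hs
      have hs' := Metric.sphere_subset_closedBall hs
      rw [mem_sphere_iff_norm] at hs
      have h1 := (hball s hs').1
      set x := s.re - 1 / 2 with hx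
      have hxr : (s - c₀).re = x := by rw [sub_re, hcre]
      have hsq : x ^ 2 + (s - c₀).im ^ 2 = D ^ 2 := by
        rw [← hs, Complex.sq_norm, Complex.normSq_apply, hxr]
        ring
      have hxD : |x| ≤ D := by
        rw [← hs, ← hxr]
        exact Complex.abs_re_le_norm _
      set m : ℝ := max (1 / 2 - s.re) 0 with hm
      have hmx : |x| / 2 - x / 2 = m := by
        rw [hm, show 1 / 2 - s.re = -x by rw [hx]; ring]
        rcases le_total 0 x with h | h
        · rw [abs_of_nonneg h, max_eq_right (by linarith)]; ring
        · rw [abs_of_nonpos h, max_eq_left (by linarith)]; ring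
      have hlogT : 0 ≤ Real.log T := Real.log_nonneg (by linarith)
      have hexp : ‖Complex.exp (Real.log T * ((s - c₀) ^ 2 / (4 * D) - (s - c₀) / 2))‖ ≤
          T ^ (m - 50) := by
        rw [Complex.norm_exp, Real.rpow_def_of_pos hT0, Complex.re_ofReal_mul]
        gcongr
        have e1 : ((s - c₀) ^ 2 / (4 * D) - (s - c₀) / 2 : ℂ).re =
            (x ^ 2 - (s - c₀).im ^ 2) / (4 * D) - x / 2 := by
          rw [show (4 * D : ℂ) = ((4 * D : ℝ) : ℂ) by push_cast; ring,
            show (2 : ℂ) = ((2 : ℝ) : ℂ) by norm_num, Complex.sub_re, Complex.div_ofReal_re,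
            Complex.div_ofReal_re, hxr, pow_two (s - c₀), mul_re, hxr]
          ring
        rw [e1, ← hmx]
        have h2 : x ^ 2 ≤ D * |x| := by
          rw [← sq_abs, pow_two]
          gcongr
        have h3 : (x ^ 2 - (s - c₀).im ^ 2) / (4 * D) ≤ |x| / 2 - D / 4 := by
          rw [div_le_iff₀ (by positivity)]
          nlinarith
        linarith
      calc ‖h s‖ = ‖riemannZeta s‖⁻¹ *
            ‖Complex.exp (Real.log T * ((s - c₀) ^ 2 / (4 * D) - (s - c₀) / 2))‖ := by
            rw [norm_mul, norm_inv]
        _ ≤ (c * T ^ (m - 26))⁻¹ * T ^ (m - 50) := by gcongr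
        _ = c⁻¹ * T ^ (-24 : ℝ) := by
            rw [mul_inv, ← Real.rpow_neg hT0.le, mul_assoc, ← Real.rpow_add hT0]
            congr 2
            ring)
    (subset_closure (Metric.mem_ball_self hDpos))
  have hcc : ‖h c₀‖ = ‖riemannZeta c₀‖⁻¹ := by simp [h]
  have hc1 : c₀ - 1 ≠ 0 := sub_ne_zero.2 (hball c₀ (Metric.mem_closedBall_self hDpos.le)).2
  have hup : ‖riemannZeta c₀‖ ≤ 24 * T ^ 2 := by
    have h1 := norm_riemannZeta₁_le_of_mem_disc (z := c₀) (y := T) (by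
      have : c₀ - (2 + T * I) = ((-(3 / 2) : ℝ) : ℂ) := by rw [hc₀]; push_cast; ring
      rw [this, Complex.norm_real]
      norm_num)
    have h2 : 1 ≤ ‖c₀ - 1‖ := by
      refine le_trans ?_ (Complex.abs_im_le_norm _)
      rw [sub_im, hcim, one_im, sub_zero, abs_of_pos hT0]
      linarith
    rw [riemannZeta_eq_inv_sub_mul (sub_ne_zero.1 hc1), norm_mul, norm_inv]
    rw [abs_of_pos hT0] at h1
    calc _ ≤ 1 * (6 * (T + 5) ^ 2) := by
          gcongr
          exact inv_le_one_of_one_le₀ h2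
      _ ≤ 1 * (6 * (T + T) ^ 2) := by gcongr
      _ = _ := by ring
  rw [hcc] at hmax
  have hpos : 0 < ‖riemannZeta c₀‖ :=
    norm_pos_iff.2 (hζ0 c₀ (Metric.mem_closedBall_self hDpos.le))
  have h1 : (24 * T ^ 2)⁻¹ ≤ c⁻¹ * T ^ (-24 : ℝ) := (by gcongr : _ ≤ _).trans hmax
  rw [show (-24 : ℝ) = -((24 : ℕ) : ℝ) by norm_num, Real.rpow_neg hT0.le, Real.rpow_natCast,
    ← mul_inv, inv_le_inv₀ (by positivity) (by positivity)] at h1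
  have h2 : 24 < c * T := by
    have : 24 / c < T := by linarith
    rwa [div_lt_iff₀' hc] at this
  have h3 : (1 : ℝ) ≤ T ^ 21 := one_le_pow₀ (by linarith)
  have h4 : c * T ^ 24 = (c * T) * T ^ 21 * T ^ 2 := by ring
  have h5 : 24 * T ^ 2 < (c * T) * T ^ 21 * T ^ 2 := by
    gcongr
    nlinarith
  linarith

theorem integrableOn_exp_arctan_mul_rpow {γ a : ℝ} (hγ : 0 ≤ γ) (ha : a < -1) :
    MeasureTheory.IntegrableOn
      (fun u : ℝ => Real.exp (-γ * Real.arctan (1 / u)) * u ^ a) (Set.Ioi 1) := by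
  refine (integrableOn_Ioi_rpow_of_lt ha one_pos).mono' ?_ ?_
  · refine Measurable.aestronglyMeasurable ?_
    fun_prop
  · refine (MeasureTheory.ae_restrict_iff' measurableSet_Ioi).2
      (Filter.Eventually.of_forall fun u hu => ?_)
    have hu0 : (0 : ℝ) < u := one_pos.trans hu
    rw [Real.norm_of_nonneg (by positivity)]
    refine mul_le_of_le_one_left (by positivity) (Real.exp_le_one_iff.2 ?_)
    have := Real.arctan_nonneg.2 (by positivity : 0 ≤ 1 / u)
    nlinarith

theorem zero_series_term_ge {α β γ : ℝ} (hα : 1 < α) (hα' : α ≤ 3 / 2) (h0 : 0 < β) (h1 : β < 1)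
    (hγ : 1 ≤ γ) : Real.exp (-1) * 2 ^ (-(5 / 2) : ℝ) * γ⁻¹ ≤ γ ^ (β - 1 / 2) *
      ∫ u in Set.Ioi (1 : ℝ), Real.exp (-γ * Real.arctan (1 / u)) * u ^ (-α - β) := by
  have hγ0 : 0 < γ := by linarith
  have hInt := integrableOn_exp_arctan_mul_rpow hγ0.le (by linarith : -α - β < -1)
  have hsub : Set.Ioc γ (2 * γ) ⊆ Set.Ioi 1 := fun u hu => lt_of_le_of_lt hγ hu.1
  have k1 := MeasureTheory.setIntegral_ge_of_const_le (s := Set.Ioc γ (2 * γ))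
    (c := Real.exp (-1) * (2 * γ) ^ (-α - β)) measurableSet_Ioc (by simp) (fun u hu => by
      have hu0 : 0 < u := hγ0.trans hu.1
      gcongr ?_ * ?_
      · rw [Real.exp_le_exp]
        have h2 := arctan_le_self (t := 1 / u) (by positivity)
        have h3 : γ * Real.arctan (1 / u) ≤ γ * (1 / u) := by gcongr
        have h4 : γ * (1 / u) ≤ 1 := by
          rw [mul_one_div, div_le_one hu0]
          exact hu.1.le
        linarith
      · exact Real.rpow_le_rpow_of_nonpos hu0 hu.2 (by linarith)) (hInt.mono_set hsub)
  have k2 := MeasureTheory.setIntegral_mono_set hInt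
    ((MeasureTheory.ae_restrict_iff' measurableSet_Ioi).2
      (Filter.Eventually.of_forall fun u (hu : 1 < u) => by
        have : 0 < u := by linarith
        simp only [Pi.zero_apply]
        positivity)) hsub.eventuallyLE
  have hvol : MeasureTheory.volume.real (Set.Ioc γ (2 * γ)) = γ := by
    rw [Real.volume_real_Ioc_of_le (by linarith)]
    ring
  rw [hvol, smul_eq_mul, mul_comm] at k1
  calc Real.exp (-1) * 2 ^ (-(5 / 2) : ℝ) * γ⁻¹
      ≤ Real.exp (-1) * 2 ^ (-α - β) * γ ^ (1 / 2 - α) := by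
        rw [← Real.rpow_neg_one]
        gcongr
        · norm_num
        · linarith
        · linarith
    _ = γ ^ (β - 1 / 2) * (Real.exp (-1) * (2 * γ) ^ (-α - β) * γ) := by
        rw [Real.mul_rpow (by norm_num) hγ0.le,
          show 1 / 2 - α = (β - 1 / 2) + (-α - β) + 1 by ring, Real.rpow_add hγ0,
          Real.rpow_add hγ0, Real.rpow_one]
        ring
    _ ≤ _ := by
        gcongr
        exact k1.trans k2

theorem exists_injective_upperZeros : ∃ (ρ : ℕ → upperZeros) (C : ℝ), 0 < C ∧
    Function.Injective ρ ∧ ∀ k : ℕ, 1 ≤ (ρ k : ℂ).im ∧ (ρ k : ℂ).im ≤ C * (k + 1) := by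
  obtain ⟨T₀, R, hR, h⟩ := exists_zetaZero_near
  set B : ℝ := max T₀ 0 + R + 1 with hB
  have hB1 : T₀ ≤ B := by linarith [le_max_left T₀ 0]
  have hB2 : R + 1 ≤ B := by linarith [le_max_right T₀ 0]
  choose ρ hρ hnear using fun k : ℕ =>
    h (B + 3 * R * k) (hB1.trans (le_add_of_nonneg_right (by positivity)))
  have hlow (k : ℕ) : B + 3 * R * k - R ≤ (ρ k).im := by linarith [(abs_le.1 (hnear k)).1]
  have hupp (k : ℕ) : (ρ k).im ≤ B + 3 * R * k + R := by linarith [(abs_le.1 (hnear k)).2]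
  have hone (k : ℕ) : 1 ≤ (ρ k).im := by
    have : 0 ≤ 3 * R * k := by positivity
    linarith [hlow k]
  have hmono : StrictMono fun k => (ρ k).im := strictMono_nat_of_lt_succ fun k => by
    have h1 := hlow (k + 1)
    push_cast at h1
    linarith [hupp k]
  refine ⟨fun k => ⟨ρ k, hρ k, by linarith [hone k]⟩, B + 4 * R, by linarith, fun a b hab => ?_,
    fun k => ⟨hone k, ?_⟩⟩
  · exact hmono.injective (congrArg (fun z : upperZeros => (z : ℂ).im) hab)
  · refine (hupp k).trans ?_
    have hk : (0 : ℝ) ≤ k := k.cast_nonneg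
    nlinarith [mul_nonneg hR.le hk, mul_nonneg (by linarith : 0 ≤ B) hk]

theorem not_summable_zero_series {α : ℝ} (hα : 1 < α) (hα' : α ≤ 3 / 2) :
    ¬ Summable (fun ρ : upperZeros =>
      (ρ : ℂ).im ^ ((ρ : ℂ).re - 1 / 2) *
        ∫ u in Set.Ioi (1 : ℝ),
          Real.exp (-(ρ : ℂ).im * Real.arctan (1 / u)) * u ^ (-α - (ρ : ℂ).re)) := by
  intro hs
  obtain ⟨ρ, C, hC, hinj, hρ⟩ := exists_injective_upperZeros
  set K : ℝ := Real.exp (-1) * 2 ^ (-(5 / 2) : ℝ) with hK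
  have hKpos : 0 < K := by positivity
  have h1 : Summable fun k : ℕ => K * (C * ((k : ℝ) + 1))⁻¹ := by
    refine Summable.of_nonneg_of_le (fun k => by positivity) (fun k => ?_)
      (hs.comp_injective hinj)
    obtain ⟨⟨-, h0, h1⟩, -⟩ := (ρ k).2
    obtain ⟨hone, hle⟩ := hρ k
    refine le_trans ?_ (zero_series_term_ge hα hα' h0 h1 hone)
    rw [← hK]
    gcongr
  have h2 : Summable fun k : ℕ => (((k + 1 : ℕ) : ℝ))⁻¹ := by
    refine (h1.mul_left (K⁻¹ * C)).congr fun k => ?_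
    push_cast
    field_simp
  exact Real.not_summable_natCast_inv ((summable_nat_add_iff 1).1 h2)

/-- The series `∑_{ρ, γ>0} γ^{β-1/2} ∫_1^∞ exp(-γ arctan(1/u)) u^{-α-β} du` converges iff
`α > 3/2`, and the same holds with an extra factor `log^c u` for any fixed `c ≥ 0`. -/
theorem zero_series_convergence (α : ℝ) (hα : 1 < α) :
    (3 / 2 < α →
      Summable (fun ρ : upperZeros =>
        (ρ : ℂ).im ^ ((ρ : ℂ).re - 1 / 2) *
          ∫ u in Set.Ioi (1 : ℝ),
            Real.exp (-(ρ : ℂ).im * Real.arctan (1 / u)) * u ^ (-α - (ρ : ℂ).re))) ∧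
    (α ≤ 3 / 2 →
      ¬ Summable (fun ρ : upperZeros =>
        (ρ : ℂ).im ^ ((ρ : ℂ).re - 1 / 2) *
          ∫ u in Set.Ioi (1 : ℝ),
            Real.exp (-(ρ : ℂ).im * Real.arctan (1 / u)) * u ^ (-α - (ρ : ℂ).re))) ∧
    (∀ c : ℝ, 0 ≤ c → 3 / 2 < α →
      Summable (fun ρ : upperZeros =>
        (ρ : ℂ).im ^ ((ρ : ℂ).re - 1 / 2) *
          ∫ u in Set.Ioi (1 : ℝ),
            Real.exp (-(ρ : ℂ).im * Real.arctan (1 / u)) * u ^ (-α - (ρ : ℂ).re) *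
              Real.log u ^ c)) := by
  refine ⟨fun h => ?_, not_summable_zero_series hα, fun c hc h => summable_zero_series h hc⟩
  simpa using summable_zero_series h le_rfl

end
end

section
/- Let k > 0, a > 0 and let N be a positive integer. Then ∑_{n ≤ N} r_SP(n)·(N−n)^k/Γ(k+1) = (1/(2πi))·∫_{(a)} e^{Nz}·z^{−k−1}·S̃₁(z)·S̃₂(z)² dz, where S̃₁(z) = ∑_{m≥1} Λ(m)e^{−mz}, S̃₂(z) = ∑_{m≥1} Λ(m)e^{−m²z}, and ∫_{(a)} denotes the integral over the vertical line Re(z) = a. -/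
open Complex ArithmeticFunction

noncomputable section

/-- `S̃₁(z) = ∑_{m ≥ 1} Λ(m) e^{-mz}`. -/
def S1 (z : ℂ) : ℂ := ∑' m : ℕ, (vonMangoldt m : ℂ) * Complex.exp (-(m : ℂ) * z)

/-- `S̃₂(z) = ∑_{m ≥ 1} Λ(m) e^{-m²z}`. -/
def S2 (z : ℂ) : ℂ := ∑' m : ℕ, (vonMangoldt m : ℂ) * Complex.exp (-(m : ℂ) ^ 2 * z)

/-- `r_SP(n) = ∑_{m₁+m₂²+m₃²=n} Λ(m₁)Λ(m₂)Λ(m₃)`. -/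
def rSP (n : ℕ) : ℝ :=
  ∑ m ∈ (Finset.range (n + 1) ×ˢ Finset.range (n + 1) ×ˢ Finset.range (n + 1)).filter
      (fun m => m.1 + m.2.1 ^ 2 + m.2.2 ^ 2 = n),
    vonMangoldt m.1 * vonMangoldt m.2.1 * vonMangoldt m.2.2

open MeasureTheory ProbabilityTheory Set

lemma integrableOn_rpow_mul_cexp_neg_mul {k : ℝ} (hk : -1 < k) {z : ℂ} (hz : 0 < z.re) :
    IntegrableOn (fun t : ℝ => ((t ^ k : ℝ) : ℂ) * Complex.exp (-z * t)) (Ioi 0) := by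
  have h := integrableOn_rpow_mul_exp_neg_mul_rpow (p := 1) hk one_pos hz
  refine h.mono' (Measurable.aestronglyMeasurable (by fun_prop)) ?_
  filter_upwards [ae_restrict_mem measurableSet_Ioi] with t ht
  have ht' : 0 ≤ t ^ k := Real.rpow_nonneg (le_of_lt ht) k
  simp [Complex.norm_exp, abs_of_nonneg ht']

/-- The Laplace transform of `t ^ k` on the right half-plane. -/
lemma integral_rpow_mul_cexp_neg_mul {k : ℝ} (hk : -1 < k) {z : ℂ} (hz : 0 < z.re) :
    ∫ t in Ioi (0 : ℝ), ((t ^ k : ℝ) : ℂ) * Complex.exp (-z * t) =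
      Real.Gamma (k + 1) * z ^ (-(k : ℂ) - 1) := by
  let d : ℝ → NNReal := fun t => Real.toNNReal (t ^ k)
  let μ : Measure ℝ := (volume.restrict (Ioi 0)).withDensity fun t => d t
  have hd : Measurable d := by fun_prop
  have smul_d (f : ℝ → ℂ) : (fun t => d t • f t) =ᵐ[volume.restrict (Ioi 0)]
      fun t => ((t ^ k : ℝ) : ℂ) * f t := by
    filter_upwards [ae_restrict_mem measurableSet_Ioi] with t ht
    simp [d, NNReal.smul_def, Real.rpow_nonneg (le_of_lt ht) k]
  have hmgf (w : ℂ) : complexMGF id μ (-w) =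
      ∫ t in Ioi (0 : ℝ), ((t ^ k : ℝ) : ℂ) * Complex.exp (-w * t) := by
    rw [complexMGF, integral_withDensity_eq_integral_smul hd]
    exact integral_congr_ae (smul_d _)
  have hset : Iio 0 ⊆ integrableExpSet id μ := by
    intro t ht
    have h : Integrable (fun x : ℝ => Complex.exp (-((-t : ℝ) : ℂ) * x)) μ := by
      rw [integrable_withDensity_iff_integrable_smul hd, integrable_congr (smul_d _)]
      exact integrableOn_rpow_mul_cexp_neg_mul hk (by simpa using ht)
    refine h.norm.congr (Filter.Eventually.of_forall fun x => ?_)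
    simp [Complex.norm_exp]
  have hana : AnalyticOnNhd ℂ (fun w => complexMGF id μ (-w)) {w | 0 < w.re} := by
    refine analyticOnNhd_complexMGF.comp analyticOnNhd_id.neg fun w hw => ?_
    exact interior_maximal hset isOpen_Iio (by simpa using hw)
  have hana' : AnalyticOnNhd ℂ (fun w : ℂ => (Real.Gamma (k + 1) : ℂ) * w ^ (-(k : ℂ) - 1))
      {w | 0 < w.re} := by
    intro w hw
    exact analyticAt_const.mul (analyticAt_id.cpow analyticAt_const (Or.inl hw))
  have hreal (r : ℝ) (hr : 0 < r) :
      complexMGF id μ (-(r : ℂ)) = Real.Gamma (k + 1) * (r : ℂ) ^ (-(k : ℂ) - 1) := by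
    rw [hmgf]
    have h := Real.integral_rpow_mul_exp_neg_mul_Ioi (a := k + 1) (by linarith) hr
    have h' := congrArg (fun x : ℝ => (x : ℂ)) h
    simp only [← integral_complex_ofReal] at h'
    convert h' using 1
    · simp
    · rw [one_div, Real.inv_rpow hr.le, ← Real.rpow_neg hr.le, Complex.ofReal_mul,
        Complex.ofReal_cpow hr.le, mul_comm]
      push_cast
      ring_nf
  have heq := hana.eqOn_of_preconnected_of_frequently_eq hana'
    (convex_halfSpace_re_gt 0).isPreconnected (z₀ := 1) (by simp) ?_
  · rw [← hmgf]
    exact heq hz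
  · have ht : Filter.Tendsto (fun r : ℝ => (r : ℂ)) (nhdsWithin 1 (Ioi 1))
        (nhdsWithin 1 {1}ᶜ) := by
      refine tendsto_nhdsWithin_iff.2 ⟨?_, ?_⟩
      · exact (Complex.continuous_ofReal.tendsto' 1 1 (by simp)).mono_left nhdsWithin_le_nhds
      · filter_upwards [self_mem_nhdsWithin] with r hr
        simpa using (ne_of_gt hr : r ≠ 1)
    refine ht.frequently (Filter.Eventually.frequently ?_)
    filter_upwards [self_mem_nhdsWithin] with r hr
    exact hreal r (zero_lt_one.trans hr)

lemma integrable_vertical_line_cpow {k a : ℝ} (hk : 0 < k) (ha : 0 < a) :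
    Integrable fun y : ℝ => ((a : ℂ) + y * Complex.I) ^ (-(k : ℂ) - 1) := by
  have hmem (y : ℝ) : (a : ℂ) + y * Complex.I ∈ Complex.slitPlane := Or.inl (by simpa using ha)
  have hcont : Continuous fun y : ℝ => ((a : ℂ) + y * Complex.I) ^ (-(k : ℂ) - 1) :=
    Continuous.cpow (by fun_prop) continuous_const hmem
  have h := (integrable_rpow_neg_one_add_norm_sq (E := ℝ) (μ := volume) (r := k + 1)
    (by simpa using hk)).comp_div ha.ne'
  refine (h.const_mul (a ^ (-(k + 1)))).mono' hcont.aestronglyMeasurable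
    (Filter.Eventually.of_forall fun y => le_of_eq ?_)
  have he : (-(k : ℂ) - 1) = ((-(k + 1) : ℝ) : ℂ) := by push_cast; ring
  rw [he, Complex.norm_cpow_real, Complex.norm_add_mul_I, Real.sqrt_eq_rpow,
    ← Real.rpow_mul (by positivity)]
  have : a ^ 2 + y ^ 2 = a ^ 2 * (1 + ‖y / a‖ ^ 2) := by
    rw [Real.norm_eq_abs, sq_abs]; field_simp
  rw [this, Real.mul_rpow (by positivity) (by positivity), ← Real.rpow_natCast a 2,
    ← Real.rpow_mul ha.le]
  push_cast
  ring_nf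

/-- The inverse Laplace transform of `z ^ (-k - 1)` along the line `Re z = a`. -/
lemma integral_vertical_line_cexp_mul_cpow {k a : ℝ} (hk : 0 < k) (ha : 0 < a) (u : ℝ) :
    ∫ y : ℝ, Complex.exp (u * ((a : ℂ) + y * Complex.I)) *
        ((a : ℂ) + y * Complex.I) ^ (-(k : ℂ) - 1) =
      2 * Real.pi * ((max u 0 ^ k : ℝ) : ℂ) / Real.Gamma (k + 1) := by
  let f : ℝ → ℂ := fun t => ((max t 0 ^ k : ℝ) : ℂ) * Complex.exp (-a * t)
  have hΓ : (Real.Gamma (k + 1) : ℂ) ≠ 0 :=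
    Complex.ofReal_ne_zero.2 (Real.Gamma_pos_of_pos (by linarith)).ne'
  have hind (w : ℂ) : (fun t : ℝ => ((max t 0 ^ k : ℝ) : ℂ) * Complex.exp (-w * t)) =
      (Ioi 0).indicator fun t : ℝ => ((t ^ k : ℝ) : ℂ) * Complex.exp (-w * t) := by
    ext t
    by_cases ht : 0 < t
    · simp [ht, ht.le]
    · simp [ht, not_lt.1 ht, hk.ne']
  have hcont : Continuous f := by
    have : Continuous fun t : ℝ => max t 0 ^ k :=
      (continuous_id.max continuous_const).rpow_const fun _ => Or.inr hk.le
    fun_prop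
  have hint : Integrable f := by
    simp only [f, hind]
    exact (integrableOn_rpow_mul_cexp_neg_mul (by linarith) (by simpa using ha)).integrable_indicator
      measurableSet_Ioi
  have hfourier : FourierTransform.fourier f = fun w : ℝ => (Real.Gamma (k + 1) : ℂ) *
      ((a : ℂ) + (2 * Real.pi * w : ℝ) * Complex.I) ^ (-(k : ℂ) - 1) := by
    ext w
    rw [Real.fourier_real_eq_integral_exp_smul, ← integral_rpow_mul_cexp_neg_mul (by linarith)
      (by simpa using ha), ← integral_indicator measurableSet_Ioi, ← hind]
    congr 1 with v
    simp only [f, smul_eq_mul]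
    rw [mul_left_comm, ← Complex.exp_add]
    congr 2
    push_cast
    ring
  have hint' : Integrable (FourierTransform.fourier f) := by
    rw [hfourier]
    exact ((integrable_vertical_line_cpow hk ha).comp_mul_left' (R := 2 * Real.pi)
      (by positivity)).const_mul _
  have hinv := congrFun (hcont.fourierInv_fourier_eq hint hint') u
  rw [Real.fourierInv_eq', hfourier] at hinv
  have hsub := Measure.integral_comp_mul_left (fun y : ℝ => Complex.exp (u * (y * Complex.I)) *
    ((a : ℂ) + y * Complex.I) ^ (-(k : ℂ) - 1)) (2 * Real.pi)
  have hl : ∫ v : ℝ, Complex.exp (((2 * Real.pi * inner ℝ v u : ℝ) : ℂ) * Complex.I) •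
      ((Real.Gamma (k + 1) : ℂ) *
        ((a : ℂ) + (2 * Real.pi * v : ℝ) * Complex.I) ^ (-(k : ℂ) - 1)) =
      (Real.Gamma (k + 1) : ℂ) * ∫ v : ℝ, Complex.exp (u * ((2 * Real.pi * v : ℝ) * Complex.I)) *
        ((a : ℂ) + (2 * Real.pi * v : ℝ) * Complex.I) ^ (-(k : ℂ) - 1) := by
    rw [← integral_const_mul]
    congr 1 with v
    have : ((2 * Real.pi * inner ℝ v u : ℝ) : ℂ) * Complex.I =
        u * ((2 * Real.pi * v : ℝ) * Complex.I) := by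
      simp
      ring
    rw [this, smul_eq_mul]
    ring
  have hr : ∫ y : ℝ, Complex.exp (u * ((a : ℂ) + y * Complex.I)) *
        ((a : ℂ) + y * Complex.I) ^ (-(k : ℂ) - 1) = Complex.exp (u * a) *
      ∫ y : ℝ, Complex.exp (u * (y * Complex.I)) *
        ((a : ℂ) + y * Complex.I) ^ (-(k : ℂ) - 1) := by
    rw [← integral_const_mul]
    congr 1 with y
    rw [mul_add, Complex.exp_add, mul_assoc]
  have hπ : (Real.pi : ℂ) ≠ 0 := Complex.ofReal_ne_zero.2 Real.pi_ne_zero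
  rw [hl, hsub, abs_of_pos (by positivity), Complex.real_smul] at hinv
  rw [hr, eq_div_iff hΓ]
  have hexp : Complex.exp (u * a) * Complex.exp (-a * u) = 1 := by
    rw [← Complex.exp_add]
    simp [mul_comm]
  simp only [f] at hinv
  push_cast at hinv
  generalize (∫ y : ℝ, Complex.exp (u * (y * Complex.I)) *
        ((a : ℂ) + y * Complex.I) ^ (-(k : ℂ) - 1)) = J at *
  have hJ : (Real.Gamma (k + 1) : ℂ) * J =
      2 * Real.pi * (((max u 0 ^ k : ℝ) : ℂ) * Complex.exp (-a * u)) := by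
    rw [← hinv]
    field_simp
  linear_combination Complex.exp (u * a) * hJ + 2 * Real.pi * ((max u 0 ^ k : ℝ) : ℂ) * hexp

lemma vonMangoldt_le_natCast (n : ℕ) : vonMangoldt n ≤ n :=
  vonMangoldt_le_log.trans (Real.log_le_self n.cast_nonneg)

lemma summable_norm_vonMangoldt_mul_cexp {z : ℂ} (hz : 0 < z.re) :
    Summable fun m : ℕ => ‖(vonMangoldt m : ℂ) * Complex.exp (-(m : ℂ) * z)‖ := by
  refine Summable.of_nonneg_of_le (fun _ => norm_nonneg _) (fun m => ?_)
    (summable_pow_mul_geometric_of_norm_lt_one 1 (r := Real.exp (-z.re))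
      (by simpa [abs_of_pos (Real.exp_pos _)] using hz))
  rw [norm_mul, Complex.norm_real, Real.norm_of_nonneg vonMangoldt_nonneg, Complex.norm_exp,
    ← Real.exp_nat_mul, pow_one]
  have h := vonMangoldt_le_natCast m
  have he : (-(m : ℂ) * z).re = m * -z.re := by simp
  rw [he]
  gcongr

lemma summable_norm_vonMangoldt_mul_cexp_sq {z : ℂ} (hz : 0 < z.re) :
    Summable fun m : ℕ => ‖(vonMangoldt m : ℂ) * Complex.exp (-(m : ℂ) ^ 2 * z)‖ := by
  refine Summable.of_nonneg_of_le (fun _ => norm_nonneg _) (fun m => ?_)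
    (summable_norm_vonMangoldt_mul_cexp hz)
  rw [norm_mul, norm_mul, Complex.norm_exp, Complex.norm_exp]
  refine mul_le_mul_of_nonneg_left (Real.exp_le_exp.2 ?_) (norm_nonneg _)
  have h : (m : ℝ) ≤ (m : ℝ) ^ 2 := by exact_mod_cast Nat.le_self_pow two_ne_zero m
  have := mul_le_mul_of_nonneg_right h hz.le
  have he : (-(m : ℂ) ^ 2 * z).re = -((m : ℝ) ^ 2 * z.re) := by
    rw [← Nat.cast_pow, neg_mul, Complex.neg_re, ← Complex.ofReal_natCast, Complex.re_ofReal_mul]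
    push_cast
    rfl
  have he' : (-(m : ℂ) * z).re = -(m * z.re) := by simp
  rw [he, he']
  exact neg_le_neg this

/-- The weight `Λ(m₁)Λ(m₂)Λ(m₃)` of a triple. -/
def tripleWeight (m : ℕ × ℕ × ℕ) : ℝ :=
  vonMangoldt m.1 * vonMangoldt m.2.1 * vonMangoldt m.2.2

/-- The number `m₁ + m₂² + m₃²` represented by a triple. -/
def tripleSum (m : ℕ × ℕ × ℕ) : ℕ := m.1 + m.2.1 ^ 2 + m.2.2 ^ 2

lemma tripleWeight_mul_cexp (m : ℕ × ℕ × ℕ) (z : ℂ) :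
    (tripleWeight m : ℂ) * Complex.exp (-(tripleSum m : ℂ) * z) =
      (vonMangoldt m.1 : ℂ) * Complex.exp (-(m.1 : ℂ) * z) *
        ((vonMangoldt m.2.1 : ℂ) * Complex.exp (-(m.2.1 : ℂ) ^ 2 * z) *
          ((vonMangoldt m.2.2 : ℂ) * Complex.exp (-(m.2.2 : ℂ) ^ 2 * z))) := by
  have : Complex.exp (-(tripleSum m : ℂ) * z) = Complex.exp (-(m.1 : ℂ) * z) *
      Complex.exp (-(m.2.1 : ℂ) ^ 2 * z) * Complex.exp (-(m.2.2 : ℂ) ^ 2 * z) := by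
    rw [← Complex.exp_add, ← Complex.exp_add, tripleSum]
    push_cast
    ring_nf
  rw [this, tripleWeight]
  push_cast
  ring

lemma summable_norm_tripleWeight_mul_cexp {z : ℂ} (hz : 0 < z.re) :
    Summable fun m => ‖(tripleWeight m : ℂ) * Complex.exp (-(tripleSum m : ℂ) * z)‖ := by
  have h₂ := summable_norm_vonMangoldt_mul_cexp_sq hz
  have h₂₂ := h₂.mul_norm h₂
  have h := (summable_norm_vonMangoldt_mul_cexp hz).mul_norm h₂₂
  exact h.congr fun m => congrArg norm (tripleWeight_mul_cexp m z).symm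

lemma S1_mul_S2_sq {z : ℂ} (hz : 0 < z.re) :
    S1 z * S2 z ^ 2 = ∑' m, (tripleWeight m : ℂ) * Complex.exp (-(tripleSum m : ℂ) * z) := by
  simp only [tripleWeight_mul_cexp]
  have h₂ := summable_norm_vonMangoldt_mul_cexp_sq hz
  rw [S1, S2, sq, tsum_mul_tsum_of_summable_norm h₂ h₂,
    tsum_mul_tsum_of_summable_norm (summable_norm_vonMangoldt_mul_cexp hz) (h₂.mul_norm h₂)]

lemma mem_range_of_tripleSum_le {m : ℕ × ℕ × ℕ} {N : ℕ} (h : tripleSum m ≤ N) :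
    m ∈ Finset.range (N + 1) ×ˢ Finset.range (N + 1) ×ˢ Finset.range (N + 1) := by
  have h₁ := Nat.le_self_pow two_ne_zero m.2.1
  have h₂ := Nat.le_self_pow two_ne_zero m.2.2
  unfold tripleSum at h
  simp only [Finset.mem_product, Finset.mem_range]
  omega

/-- Summing over triples by the number they represent. -/
lemma tsum_tripleWeight_mul (N : ℕ) (g : ℕ → ℂ) (hg : ∀ n, N < n → g n = 0) :
    ∑' m, (tripleWeight m : ℂ) * g (tripleSum m) =
      ∑ n ∈ Finset.range (N + 1), (rSP n : ℂ) * g n := by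
  set s := Finset.range (N + 1) ×ˢ Finset.range (N + 1) ×ˢ Finset.range (N + 1) with hs
  have hrSP (n : ℕ) (hn : n ∈ Finset.range (N + 1)) :
      (rSP n : ℂ) * g n =
        ∑ m ∈ s with tripleSum m = n, (tripleWeight m : ℂ) * g (tripleSum m) := by
    have hfilter : (Finset.range (n + 1) ×ˢ Finset.range (n + 1) ×ˢ Finset.range (n + 1)).filter
        (fun m => m.1 + m.2.1 ^ 2 + m.2.2 ^ 2 = n) = s.filter (fun m => tripleSum m = n) := by
      ext m
      simp only [Finset.mem_filter]
      refine ⟨fun h => ⟨mem_range_of_tripleSum_le ?_, h.2⟩,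
        fun h => ⟨mem_range_of_tripleSum_le ?_, h.2⟩⟩
      · exact h.2.le.trans (Finset.mem_range_succ_iff.1 hn)
      · exact h.2.le
    rw [rSP, hfilter, Complex.ofReal_sum, Finset.sum_mul]
    refine Finset.sum_congr rfl fun m hm => ?_
    rw [(Finset.mem_filter.1 hm).2, tripleWeight]
  rw [Finset.sum_congr rfl hrSP, Finset.sum_fiberwise_eq_sum_filter, tsum_eq_sum]
  intro m hm
  rw [hg, mul_zero]
  by_contra! h
  exact hm (Finset.mem_filter.2 ⟨mem_range_of_tripleSum_le h, Finset.mem_range_succ_iff.2 h⟩)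

/-- The Cesàro average of `r_SP` as a vertical line integral. -/
theorem cesaro_eq_line_integral (k a : ℝ) (hk : 0 < k) (ha : 0 < a) (N : ℕ) (hN : 0 < N) :
    (∑ n ∈ Finset.range (N + 1),
        (rSP n : ℂ) * ((((N : ℝ) - n) ^ k : ℝ) : ℂ) / (Real.Gamma (k + 1) : ℂ))
      = (1 / (2 * Real.pi * Complex.I)) *
          ∫ y : ℝ,
            Complex.exp ((N : ℂ) * ((a : ℂ) + y * Complex.I)) *
              ((a : ℂ) + y * Complex.I) ^ (-(k : ℂ) - 1) *
                S1 ((a : ℂ) + y * Complex.I) * (S2 ((a : ℂ) + y * Complex.I)) ^ 2 *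
                  Complex.I := by
  have hre (y : ℝ) : 0 < ((a : ℂ) + y * Complex.I).re := by simpa using ha
  let F : ℕ × ℕ × ℕ → ℝ → ℂ := fun m y => (tripleWeight m : ℂ) *
    (Complex.exp (((N - tripleSum m : ℝ) : ℂ) * ((a : ℂ) + y * Complex.I)) *
      ((a : ℂ) + y * Complex.I) ^ (-(k : ℂ) - 1))
  have hnorm (m : ℕ × ℕ × ℕ) (y : ℝ) : ‖F m y‖ = Real.exp (N * a) *
      ‖(tripleWeight m : ℂ) * Complex.exp (-(tripleSum m : ℂ) * a)‖ *
        ‖((a : ℂ) + y * Complex.I) ^ (-(k : ℂ) - 1)‖ := by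
    simp only [F, norm_mul, Complex.norm_exp]
    rw [mul_left_comm (Real.exp _), ← Real.exp_add, mul_assoc]
    congr 3
    simp
    ring
  have hint (m : ℕ × ℕ × ℕ) : Integrable (F m) := by
    have h := (integrable_vertical_line_cpow hk ha).norm.const_mul (Real.exp (N * a) *
      ‖(tripleWeight m : ℂ) * Complex.exp (-(tripleSum m : ℂ) * a)‖)
    refine h.mono' (Measurable.aestronglyMeasurable (by fun_prop)) ?_
    exact Filter.Eventually.of_forall fun y => (hnorm m y).le
  have hsum : Summable fun m => ∫ y, ‖F m y‖ := by
    simp only [hnorm, integral_const_mul]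
    exact ((summable_norm_tripleWeight_mul_cexp (z := a) (by simpa using ha)).mul_left _).mul_right _
  have hF (y : ℝ) : Complex.exp ((N : ℂ) * ((a : ℂ) + y * Complex.I)) *
      ((a : ℂ) + y * Complex.I) ^ (-(k : ℂ) - 1) *
        S1 ((a : ℂ) + y * Complex.I) * (S2 ((a : ℂ) + y * Complex.I)) ^ 2 *
          Complex.I = (∑' m, F m y) * Complex.I := by
    rw [mul_assoc _ (S1 _), S1_mul_S2_sq (hre y), ← tsum_mul_left]
    congr 2 with m
    have : Complex.exp (((N - tripleSum m : ℝ) : ℂ) * ((a : ℂ) + y * Complex.I)) =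
        Complex.exp ((N : ℂ) * ((a : ℂ) + y * Complex.I)) *
          Complex.exp (-(tripleSum m : ℂ) * ((a : ℂ) + y * Complex.I)) := by
      rw [← Complex.exp_add]
      push_cast
      ring_nf
    simp only [F, this]
    ring
  simp only [hF]
  rw [integral_mul_const, ← integral_tsum_of_summable_integral_norm hint hsum]
  simp only [F, integral_const_mul, integral_vertical_line_cexp_mul_cpow hk ha]
  rw [tsum_tripleWeight_mul N (fun n => 2 * Real.pi * ((max ((N : ℝ) - n) 0 ^ k : ℝ) : ℂ) /
    Real.Gamma (k + 1)), Finset.sum_mul, Finset.mul_sum]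
  · refine Finset.sum_congr rfl fun n hn => ?_
    have hn' : (n : ℝ) ≤ N := by exact_mod_cast Finset.mem_range_succ_iff.1 hn
    rw [max_eq_left (sub_nonneg.2 hn')]
    field_simp
  · intro n hn
    have hn' : (N : ℝ) ≤ n := by exact_mod_cast hn.le
    simp [max_eq_right (sub_nonpos.2 hn'), hk.ne']

end
end

section
/- Let N > 1 be an integer and k > −1/2 real. Then the series-integral converges absolutely and (1/(8i))·∫_{(1/N)} e^{Nz}·z^{−k−2}·∑_ρ z^{−ρ}Γ(ρ) dz = (N^{k+1}π/4)·∑_ρ N^ρ·Γ(ρ)/Γ(k+2+ρ), where ρ runs over the non-trivial zeros of the Riemann zeta function and ∫_{(1/N)} denotes the integral over the vertical line Re(z) = 1/N. -/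
open Complex

noncomputable section

theorem WeakFEPair.exists_norm_Λ₀_le {E : Type*} [NormedAddCommGroup E] [NormedSpace ℂ E]
    (P : WeakFEPair E) (a b : ℝ) :
    ∃ C, ∀ s : ℂ, a ≤ s.re → s.re ≤ b → ‖P.Λ₀ s‖ ≤ C := by
  have conv (s : ℂ) : MeasureTheory.IntegrableOn
      (fun t : ℝ => t ^ (s.re - 1) * ‖P.f_modif t‖) (Set.Ioi 0) := by
    refine (P.isStrongFEPair_toStrongFEPair.hasMellin s).1.norm.congr ?_
    filter_upwards [MeasureTheory.ae_restrict_mem measurableSet_Ioi] with t ht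
    rw [norm_smul, norm_cpow_eq_rpow_re_of_pos ht]
    simp [WeakFEPair.toStrongFEPair]
  refine ⟨∫ t in Set.Ioi (0 : ℝ),
    (t ^ (a - 1) * ‖P.f_modif t‖ + t ^ (b - 1) * ‖P.f_modif t‖), fun s has hsb => ?_⟩
  rw [WeakFEPair.Λ₀, mellin]
  refine (MeasureTheory.norm_integral_le_integral_norm _).trans ?_
  refine MeasureTheory.integral_mono_of_nonneg (.of_forall fun _ => norm_nonneg _) ?_ ?_
  · simpa using! (conv a).add (conv b)
  filter_upwards [MeasureTheory.ae_restrict_mem measurableSet_Ioi] with t ht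
  have ht' : (0 : ℝ) < t := ht
  rw [norm_smul, norm_cpow_eq_rpow_re_of_pos ht, ← add_mul]
  gcongr
  simp only [sub_re, one_re]
  rcases le_total 1 t with h | h
  · exact (Real.rpow_le_rpow_of_exponent_le h (by linarith)).trans
      (le_add_of_nonneg_left (by positivity))
  · exact (Real.rpow_le_rpow_of_exponent_ge ht' h (by linarith)).trans
      (le_add_of_nonneg_right (by positivity))

theorem exists_norm_completedRiemannZeta₀_le (a b : ℝ) :
    ∃ C, ∀ s : ℂ, a ≤ s.re → s.re ≤ b → ‖completedRiemannZeta₀ s‖ ≤ C := by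
  obtain ⟨C, hC⟩ := (HurwitzZeta.hurwitzEvenFEPair 0).exists_norm_Λ₀_le (a / 2) (b / 2)
  refine ⟨C / 2, fun s has hsb => ?_⟩
  rw [completedRiemannZeta₀, HurwitzZeta.completedHurwitzZetaEven₀, norm_div]
  have : (s / 2).re = s.re / 2 := by simp
  have key := hC (s / 2) (by linarith) (by linarith)
  rw [norm_ofNat]
  gcongr

theorem norm_Gamma_le_Gamma_re {s : ℂ} (hs : 0 < s.re) : ‖Gamma s‖ ≤ Real.Gamma s.re := by
  rw [Gamma_eq_integral hs, Real.Gamma_eq_integral hs, GammaIntegral]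
  refine (MeasureTheory.norm_integral_le_integral_norm _).trans (le_of_eq ?_)
  refine MeasureTheory.setIntegral_congr_fun measurableSet_Ioi fun t ht => ?_
  simp only [norm_mul, norm_cpow_eq_rpow_re_of_pos ht, norm_real, sub_re, one_re]
  rw [Real.norm_of_nonneg (Real.exp_pos _).le]

theorem norm_riemannZeta_le_of_two_le_re {s : ℂ} (hs : 2 ≤ s.re) :
    ‖riemannZeta s‖ ≤ ∑' n : ℕ, 1 / (n : ℝ) ^ (2 : ℕ) := by
  rw [zeta_eq_tsum_one_div_nat_cpow (by linarith)]
  refine tsum_of_norm_bounded (Real.summable_one_div_nat_pow.2 one_lt_two).hasSum fun n => ?_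
  rcases n.eq_zero_or_pos with rfl | hn
  · rw [Nat.cast_zero, zero_cpow (by rintro rfl; norm_num at hs)]; simp
  have : (1 : ℝ) ≤ n := by exact_mod_cast hn
  rw [norm_div, norm_one, norm_natCast_cpow_of_pos hn, ← Real.rpow_natCast]
  gcongr
  exact_mod_cast hs

theorem exists_norm_completedRiemannZeta₀_le_pow :
    ∃ C, 0 ≤ C ∧ ∀ (n : ℕ) (s : ℂ), 1 ≤ n → 1 / 2 ≤ s.re → ‖s‖ ≤ n →
      ‖completedRiemannZeta₀ s‖ ≤ C * (n : ℝ) ^ n := by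
  obtain ⟨C₁, hC₁⟩ := exists_norm_completedRiemannZeta₀_le 0 4
  set Z : ℝ := ∑' n : ℕ, 1 / (n : ℝ) ^ (2 : ℕ)
  have hZ : 0 ≤ Z := tsum_nonneg fun n => by positivity
  refine ⟨max C₁ 0 + (Z + 2), by positivity, fun n s hn hs hsn => ?_⟩
  have hn' : (1 : ℝ) ≤ n := by exact_mod_cast hn
  have hnn : (1 : ℝ) ≤ (n : ℝ) ^ n := one_le_pow₀ hn'
  rcases le_total s.re 4 with h4 | h4
  · calc _ ≤ max C₁ 0 * 1 := by rw [mul_one]; exact (hC₁ s (by linarith) h4).trans (le_max_left _ _)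
      _ ≤ _ := by gcongr; linarith
  have hs0 : s ≠ 0 := by rintro rfl; norm_num at h4
  have hΛ : completedRiemannZeta s = Gammaℝ s * riemannZeta s := by
    rw [riemannZeta_def_of_ne_zero hs0,
      mul_div_cancel₀ _ (Gammaℝ_ne_zero_of_re_pos (by linarith))]
  have hre : (s / 2).re = s.re / 2 := by simp
  have hG : ‖Gammaℝ s‖ ≤ (n : ℝ) ^ n := by
    rw [Gammaℝ_def, norm_mul, norm_cpow_eq_rpow_re_of_pos Real.pi_pos]
    have h1 : Real.pi ^ (-s / 2).re ≤ 1 := by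
      refine Real.rpow_le_one_of_one_le_of_nonpos (by linarith [Real.pi_gt_three]) ?_
      simp; linarith
    have h2 : ‖Gamma (s / 2)‖ ≤ (n : ℝ) ^ n := by
      refine (norm_Gamma_le_Gamma_re (by rw [hre]; linarith)).trans ?_
      have : s.re / 2 ≤ n + 1 := by linarith [(re_le_norm s).trans hsn]
      calc Real.Gamma (s / 2).re ≤ Real.Gamma (n + 1) := by
            rw [hre]
            exact Real.Gamma_strictMonoOn_Ici.monotoneOn (by simp; linarith)
              (by simp; linarith [(re_le_norm s).trans hsn]) this
        _ = (n.factorial : ℝ) := Real.Gamma_nat_eq_factorial n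
        _ ≤ _ := by exact_mod_cast n.factorial_le_pow
    calc _ ≤ 1 * (n : ℝ) ^ n := by gcongr
      _ = _ := one_mul _
  have h0 : completedRiemannZeta₀ s = completedRiemannZeta s + 1 / s + 1 / (1 - s) := by
    rw [completedRiemannZeta_eq]; ring
  have h5 : ‖1 / s‖ ≤ 1 := by
    rw [norm_div, norm_one]
    exact div_le_one_of_le₀ (by linarith [re_le_norm s]) (norm_nonneg _)
  have h6 : ‖1 / (1 - s)‖ ≤ 1 := by
    rw [norm_div, norm_one]
    have := abs_re_le_norm (1 - s)
    rw [sub_re, one_re, abs_of_neg (by linarith)] at this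
    exact div_le_one_of_le₀ (by linarith) (norm_nonneg _)
  calc _ ≤ ‖completedRiemannZeta s‖ + ‖1 / s‖ + ‖1 / (1 - s)‖ := by rw [h0]; exact norm_add₃_le
    _ ≤ (n : ℝ) ^ n * Z + 1 + 1 := by
      rw [hΛ, norm_mul]
      gcongr
      exact norm_riemannZeta_le_of_two_le_re (by linarith)
    _ ≤ _ := by nlinarith [le_max_right C₁ 0]

/-- The entire function `1 - s (1 - s) Λ₀(s)`, which equals `-s (1 - s) Λ(s)` away from the poles. -/
noncomputable def entireXi (s : ℂ) : ℂ := 1 - s * (1 - s) * completedRiemannZeta₀ s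

theorem differentiable_entireXi : Differentiable ℂ entireXi := by
  have := differentiable_completedZeta₀
  unfold entireXi
  fun_prop

theorem entireXi_zero : entireXi 0 = 1 := by simp [entireXi]

theorem entireXi_eq_zero_of_riemannZeta_eq_zero {s : ℂ} (h : riemannZeta s = 0) (h0 : 0 < s.re)
    (h1 : s.re < 1) : entireXi s = 0 := by
  have hs0 : s ≠ 0 := by rintro rfl; simp at h0
  have hs1 : 1 - s ≠ 0 := by
    intro h; rw [← sub_eq_zero.1 h] at h1; simp at h1
  rw [riemannZeta_def_of_ne_zero hs0, div_eq_zero_iff,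
    or_iff_left (Gammaℝ_ne_zero_of_re_pos h0), completedRiemannZeta_eq] at h
  have : completedRiemannZeta₀ s = 1 / s + 1 / (1 - s) := by linear_combination h
  rw [entireXi, this]
  field_simp
  ring

theorem exists_norm_entireXi_le :
    ∃ C, 1 ≤ C ∧ ∀ (n : ℕ) (s : ℂ), 1 ≤ n → ‖s‖ ≤ n →
      ‖entireXi s‖ ≤ C * ((n : ℝ) + 1) ^ (n + 3) := by
  obtain ⟨C, hC0, hC⟩ := exists_norm_completedRiemannZeta₀_le_pow
  refine ⟨C + 1, by linarith, fun n s hn hs => ?_⟩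
  have hs' : ‖1 - s‖ ≤ (n : ℝ) + 1 := (norm_sub_le _ _).trans (by rw [norm_one]; linarith)
  have key : ‖completedRiemannZeta₀ s‖ ≤ C * ((n : ℝ) + 1) ^ (n + 1) := by
    rcases le_total (1 / 2) s.re with h | h
    · simpa using hC (n + 1) s (by omega) h (by push_cast; linarith)
    · rw [← completedRiemannZeta₀_one_sub]
      simpa using hC (n + 1) (1 - s) (by omega) (by simp; linarith) (by push_cast; linarith)
  have h1 : (1 : ℝ) ≤ ((n : ℝ) + 1) ^ (n + 3) := one_le_pow₀ (by linarith [n.cast_nonneg (α := ℝ)])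
  calc ‖entireXi s‖ ≤ 1 + ‖s‖ * ‖1 - s‖ * ‖completedRiemannZeta₀ s‖ := by
        rw [entireXi]
        refine (norm_sub_le _ _).trans ?_
        simp
    _ ≤ 1 + (n + 1) * (n + 1) * (C * ((n : ℝ) + 1) ^ (n + 1)) := by
        gcongr; linarith
    _ = 1 + C * ((n : ℝ) + 1) ^ (n + 3) := by ring
    _ ≤ _ := by linarith

theorem card_le_of_forall_eq_zero {f : ℂ → ℂ} (hf : Differentiable ℂ f) (hf0 : f 0 = 1)
    {r M : ℝ} (hr : 0 < r) (hM : 1 ≤ M) (hb : ∀ z, ‖z‖ = 2 * r → ‖f z‖ ≤ M)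
    (S : Finset ℂ) (hS : ∀ z ∈ S, f z = 0 ∧ ‖z‖ ≤ r) :
    (S.card : ℝ) ≤ Real.log M / Real.log 2 := by
  have hA (U : Set ℂ) : AnalyticOnNhd ℂ f U := fun z _ => hf.analyticAt z
  have hr2 : |2 * r| = 2 * r := abs_of_pos (by positivity)
  have key := AnalyticOnNhd.sum_divisor_le (c := 0) (r := r) (R := 2 * r) (M := M) (f := f)
    (abs_pos.2 hr.ne') (by rw [hr2, abs_of_pos hr]; linarith) hM (hA _) (by simp [hf0])
    (fun z hz => hb z (by simpa [hr2] using hz))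
  rw [hf0, norm_one, div_one, mul_div_cancel_right₀ _ hr.ne'] at key
  refine le_trans ?_ key
  set D := MeromorphicOn.divisor f (Metric.closedBall 0 |r|) with hD
  have hDnn : ∀ z, 0 ≤ D z := fun z => MeromorphicOn.AnalyticOnNhd.divisor_nonneg (hA _) z
  have hfin : (Function.support D).Finite := D.finiteSupport (isCompact_closedBall _ _)
  have hne (z : ℂ) : analyticOrderAt f z ≠ ⊤ :=
    AnalyticOnNhd.analyticOrderAt_ne_top_of_isPreconnected (hA Set.univ) isPreconnected_univ
      (Set.mem_univ 0) (Set.mem_univ z)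
      (by rw [(hf.analyticAt 0).analyticOrderAt_eq_zero.2 (by simp [hf0])]; simp)
  have h1 : ∀ z ∈ S, 1 ≤ D z := fun z hz => by
    have hzb : z ∈ Metric.closedBall (0 : ℂ) |r| := by
      simpa [abs_of_pos hr] using (hS z hz).2
    rw [hD, MeromorphicOn.AnalyticOnNhd.divisor_apply (hA _) hzb]
    obtain ⟨n, hn⟩ := ENat.ne_top_iff_exists.1 (hne z)
    have : analyticOrderAt f z ≠ 0 := (hf.analyticAt z).analyticOrderAt_ne_zero.2 (hS z hz).1
    rw [← hn] at this ⊢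
    have h0 : n ≠ 0 := by exact_mod_cast this
    simp
    omega
  have hsub : S ⊆ hfin.toFinset := fun z hz => by
    simp only [Set.Finite.mem_toFinset, Function.mem_support]
    have := h1 z hz
    omega
  rw [finsum_eq_sum_of_support_subset (s := hfin.toFinset) _ (by simp)]
  have : (S.card : ℤ) ≤ ∑ z ∈ hfin.toFinset, D z := by
    calc (S.card : ℤ) = ∑ z ∈ S, 1 := by simp
      _ ≤ ∑ z ∈ S, D z := Finset.sum_le_sum h1
      _ ≤ _ := Finset.sum_le_sum_of_subset_of_nonneg hsub fun z _ _ => hDnn z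
  exact_mod_cast this

theorem exists_card_zeros_le :
    ∃ K, 0 ≤ K ∧ ∀ (m : ℕ) (S : Finset ℂ),
      (∀ z ∈ S, entireXi z = 0 ∧ ‖z‖ ≤ (2 : ℝ) ^ m) → (S.card : ℝ) ≤ K * ((m + 1) * 2 ^ m) := by
  obtain ⟨C, hC1, hC⟩ := exists_norm_entireXi_le
  have hl2 : 0 < Real.log 2 := Real.log_pos one_lt_two
  refine ⟨Real.log C / Real.log 2 + 10, by have := Real.log_nonneg hC1; positivity,
    fun m S hS => ?_⟩
  have hn1 : 1 ≤ 2 ^ (m + 1) := Nat.one_le_two_pow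
  have hM : 1 ≤ C * (((2 ^ (m + 1) : ℕ) : ℝ) + 1) ^ (2 ^ (m + 1) + 3) :=
    one_le_mul_of_one_le_of_one_le hC1 (one_le_pow₀ (by simp))
  have := card_le_of_forall_eq_zero differentiable_entireXi entireXi_zero (r := 2 ^ m)
    (by positivity) hM (fun z hz => hC _ z hn1 (by rw [hz]; push_cast; rw [pow_succ']))
    S hS
  refine this.trans ?_
  have hlog : Real.log (((2 ^ (m + 1) : ℕ) : ℝ) + 1) ≤ (m + 2) * Real.log 2 := by
    have h2 : (((2 ^ (m + 1) : ℕ) : ℝ) + 1) ≤ 2 ^ (m + 2) := by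
      have : (1 : ℝ) ≤ 2 ^ (m + 1) := one_le_pow₀ one_le_two
      push_cast; rw [pow_succ 2 (m + 1)]; linarith
    calc _ ≤ Real.log (2 ^ (m + 2)) := Real.log_le_log (by positivity) h2
      _ = _ := by rw [Real.log_pow]; push_cast; ring
  have hp : (1 : ℝ) ≤ 2 ^ m := one_le_pow₀ one_le_two
  have hm : (0 : ℝ) ≤ m := m.cast_nonneg
  rw [Real.log_mul (by positivity) (by positivity), Real.log_pow, add_div, add_mul]
  have hC0 : 0 ≤ Real.log C / Real.log 2 := by have := Real.log_nonneg hC1; positivity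
  have hx : (1 : ℝ) ≤ (m + 1) * 2 ^ m := by nlinarith
  gcongr
  · nlinarith
  · rw [div_le_iff₀ hl2]
    calc _ ≤ ((2 ^ (m + 1) + 3 : ℕ) : ℝ) * ((m + 2) * Real.log 2) := by gcongr
      _ = ((2 * 2 ^ m + 3) * (m + 2)) * Real.log 2 := by push_cast; ring
      _ ≤ _ := by
        refine mul_le_mul_of_nonneg_right ?_ hl2.le
        nlinarith [mul_nonneg hm (sub_nonneg.2 hp)]

theorem summable_one_add_norm_rpow_of_card_le {Z : Set ℂ} {K p : ℝ} (hp : 1 < p)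
    (hK : ∀ (m : ℕ) (S : Finset ℂ), (∀ z ∈ S, z ∈ Z ∧ ‖z‖ ≤ (2 : ℝ) ^ m) →
      (S.card : ℝ) ≤ K * ((m + 1) * 2 ^ m)) :
    Summable fun z : Z => (1 + ‖(z : ℂ)‖) ^ (-p) := by
  classical
  set q : ℝ := 2 ^ (1 - p) with hq
  have hq0 : 0 < q := by positivity
  have hq1 : q < 1 := Real.rpow_lt_one_of_one_lt_of_neg one_lt_two (by linarith)
  have hsum : Summable fun m : ℕ => K * 2 * ((m + 2) * q ^ m) := by
    have h1 := summable_pow_mul_geometric_of_norm_lt_one 1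
      (r := q) (by rwa [Real.norm_of_nonneg hq0.le])
    have h2 := (summable_geometric_of_lt_one hq0.le hq1).mul_left 2
    refine ((h1.add h2).mul_left (K * 2)).congr fun m => ?_
    simp only [pow_one]; ring
  have hK0 : 0 ≤ K := by simpa using hK 0 ∅ (by simp)
  refine summable_of_sum_le (c := ∑' m : ℕ, K * 2 * ((m + 2) * q ^ m))
    (fun z => by positivity) fun u => ?_
  let l : Z → ℕ := fun z => Nat.log 2 ⌊1 + ‖(z : ℂ)‖⌋₊
  rw [← Finset.sum_fiberwise_of_maps_to (t := u.image l) (g := l)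
    (fun z hz => Finset.mem_image_of_mem _ hz)]
  refine le_trans (Finset.sum_le_sum fun m _ => ?_)
    (hsum.sum_le_tsum _ fun m _ => by positivity)
  have hl (z : Z) (hz : l z = m) : (2 : ℝ) ^ m ≤ 1 + ‖(z : ℂ)‖ ∧ ‖(z : ℂ)‖ ≤ 2 ^ (m + 1) := by
    have hfl : ⌊1 + ‖(z : ℂ)‖⌋₊ ≠ 0 := by
      rw [Ne, Nat.floor_eq_zero, not_lt]; linarith [norm_nonneg (z : ℂ)]
    constructor
    · have := Nat.pow_log_le_self 2 hfl
      rw [show Nat.log 2 ⌊1 + ‖(z : ℂ)‖⌋₊ = m from hz] at this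
      exact le_trans (by exact_mod_cast this) (Nat.floor_le (by positivity))
    · have := Nat.lt_pow_succ_log_self one_lt_two ⌊1 + ‖(z : ℂ)‖⌋₊
      rw [show Nat.log 2 ⌊1 + ‖(z : ℂ)‖⌋₊ = m from hz] at this
      have h2 := (Nat.floor_lt (by positivity)).1 this
      push_cast [Nat.succ_eq_add_one] at h2
      linarith
  have hcard : ((u.filter fun z => l z = m).card : ℝ) ≤ K * ((m + 2) * 2 ^ (m + 1)) := by
    have := hK (m + 1) ((u.filter fun z => l z = m).map (Function.Embedding.subtype _)) (by
      intro z hz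
      obtain ⟨w, hw, rfl⟩ := Finset.mem_map.1 hz
      exact ⟨w.2, (hl w (Finset.mem_filter.1 hw).2).2⟩)
    rw [Finset.card_map] at this
    push_cast at this
    convert this using 3
    ring
  calc ∑ z ∈ u with l z = m, (1 + ‖(z : ℂ)‖) ^ (-p)
      ≤ ∑ z ∈ u with l z = m, ((2 : ℝ) ^ m) ^ (-p) := by
        refine Finset.sum_le_sum fun z hz => ?_
        exact Real.rpow_le_rpow_of_nonpos (by positivity) (hl z (Finset.mem_filter.1 hz).2).1
          (by linarith)
    _ = ((u.filter fun z => l z = m).card : ℝ) * ((2 : ℝ) ^ m) ^ (-p) := by simp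
    _ ≤ K * ((m + 2) * 2 ^ (m + 1)) * ((2 : ℝ) ^ m) ^ (-p) := by gcongr
    _ = _ := by
      have : q ^ m = 2 ^ m * ((2 : ℝ) ^ m) ^ (-p) := by
        rw [hq, ← Real.rpow_natCast, ← Real.rpow_natCast, ← Real.rpow_mul two_pos.le,
          ← Real.rpow_mul two_pos.le, ← Real.rpow_add two_pos]
        congr 1; ring
      rw [this]; ring

theorem norm_Gamma_half_add_mul_I_le (t : ℝ) :
    ‖Gamma (1 / 2 + t * I)‖ ≤ 3 * Real.exp (-(Real.pi * |t| / 2)) := by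
  have h1 : ‖Gamma (1 / 2 + t * I)‖ ^ 2 = Real.pi / Real.cosh (Real.pi * t) := by
    have h := Gamma_mul_Gamma_one_sub (1 / 2 + t * I)
    have hc : (1 : ℂ) - (1 / 2 + t * I) = (starRingEnd ℂ) (1 / 2 + t * I) := by
      simp only [map_add, map_mul, conj_ofReal, conj_I, map_div₀, map_one, map_ofNat]
      ring
    have hs : sin (Real.pi * (1 / 2 + t * I)) = (Real.cosh (Real.pi * t) : ℝ) := by
      rw [show (Real.pi : ℂ) * (1 / 2 + t * I) = Real.pi * t * I + Real.pi / 2 by ring,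
        sin_add_pi_div_two, cos_mul_I]
      push_cast; rfl
    rw [hc, Gamma_conj, mul_conj, hs, ← ofReal_div, ofReal_inj] at h
    rw [← h, normSq_eq_norm_sq]
  refine (sq_le_sq₀ (norm_nonneg _) (by positivity)).1 ?_
  rw [h1, mul_pow, ← Real.exp_nat_mul]
  have h2 : Real.exp (Real.pi * |t|) / 2 ≤ Real.cosh (Real.pi * t) := by
    rw [← Real.cosh_abs, abs_mul, abs_of_pos Real.pi_pos, Real.cosh_eq]
    have := Real.exp_pos (-(Real.pi * |t|))
    linarith
  rw [div_le_iff₀ (Real.cosh_pos _)]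
  have h3 : Real.exp (((2 : ℕ) : ℝ) * -(Real.pi * |t| / 2)) * Real.exp (Real.pi * |t|) = 1 := by
    rw [← Real.exp_add, Real.exp_eq_one_iff]; push_cast; ring
  have h4 := Real.pi_lt_four
  have h5 := mul_le_mul_of_nonneg_left h2
    (Real.exp_pos (((2 : ℕ) : ℝ) * -(Real.pi * |t| / 2))).le
  linarith

theorem norm_Gamma_three_halves_add_mul_I_le (t : ℝ) :
    ‖Gamma (3 / 2 + t * I)‖ ≤ 3 * (1 / 2 + |t|) * Real.exp (-(Real.pi * |t| / 2)) := by
  have h0 : (1 / 2 + t * I : ℂ) ≠ 0 := fun h => by simpa using congrArg re h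
  have hn : ‖(1 / 2 + t * I : ℂ)‖ ≤ 1 / 2 + |t| := by
    refine (norm_add_le _ _).trans ?_
    simp
  rw [show (3 / 2 + t * I : ℂ) = (1 / 2 + t * I) + 1 by ring, Gamma_add_one _ h0, norm_mul]
  calc _ ≤ (1 / 2 + |t|) * (3 * Real.exp (-(Real.pi * |t| / 2))) := by
        gcongr
        exact norm_Gamma_half_add_mul_I_le t
    _ = _ := by ring

theorem norm_Gamma_le_of_half_le_re {s : ℂ} (h1 : 1 / 2 ≤ s.re) (h2 : s.re ≤ 3 / 2)
    (hT : 1 ≤ s.im) :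
    ‖Gamma s‖ ≤ 16 * s.im ^ (s.re - 1 / 2) * Real.exp (-(Real.pi * s.im / 2)) := by
  set T := s.im with hTdef
  have hT0 : 0 < T := one_pos.trans_le hT
  have hTc : (T : ℂ) ≠ 0 := ofReal_ne_zero.2 hT0.ne'
  set F : ℂ → ℂ := fun w => Gamma w * exp (-(I * Real.pi * w / 2)) * (T : ℂ) ^ (1 / 2 - w) *
    (T / (w + T)) with hF
  have hFn (w : ℂ) : ‖F w‖ = ‖Gamma w‖ * Real.exp (Real.pi * w.im / 2) * T ^ (1 / 2 - w.re) *
      (T / ‖w + T‖) := by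
    simp only [hF, norm_mul, norm_div, norm_exp, norm_cpow_eq_rpow_re_of_pos hT0, norm_real,
      Real.norm_of_nonneg hT0.le]
    congr 3
    · congr 1
      simp
      ring
    · simp
  have hre (w : ℂ) (hw : 0 ≤ w.re) : T + w.re ≤ ‖w + T‖ := by
    refine le_trans (le_of_eq ?_) ((le_abs_self _).trans (abs_re_le_norm _))
    simp [add_comm]
  have him (w : ℂ) : |w.im| ≤ ‖w + T‖ := by simpa using abs_im_le_norm (w + T)
  have hne (w : ℂ) (hw : 0 ≤ w.re) : w + T ≠ 0 := norm_pos_iff.1 (by linarith [hre w hw])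
  have hdiff : DifferentiableOn ℂ F {w | 0 < w.re} := by
    intro w hw
    have hw : 0 < w.re := hw
    have hG : DifferentiableAt ℂ Gamma w := differentiableAt_Gamma w fun m hm => by
      have := congrArg re hm; simp at this; linarith [(Nat.cast_nonneg m : (0 : ℝ) ≤ m)]
    refine DifferentiableAt.differentiableWithinAt ?_
    refine ((hG.mul (by fun_prop)).mul ?_).mul ?_
    · exact DifferentiableAt.const_cpow (by fun_prop) (Or.inl hTc)
    · exact DifferentiableAt.div (by fun_prop) (by fun_prop) (hne w hw.le)
  have hbd (v : ℝ) : Real.exp (-(Real.pi * |v| / 2)) * Real.exp (Real.pi * v / 2) ≤ 1 := by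
    rw [← Real.exp_add, Real.exp_le_one_iff]
    nlinarith [le_abs_self v, Real.pi_pos]
  have key : ‖F s‖ ≤ 9 / 2 := by
    refine PhragmenLindelof.vertical_strip (a := 1 / 2) (b := 3 / 2) ?_ ?_ ?_ ?_ h1 h2
    · refine DifferentiableOn.diffContOnCl (hdiff.mono ?_)
      rw [closure_preimage_re, closure_Ioo (by norm_num)]
      intro w hw
      exact lt_of_lt_of_le (by norm_num) hw.1
    · refine ⟨1, by rw [lt_div_iff₀ (by norm_num)]; linarith [Real.pi_gt_three],
        Real.pi / 2, ?_⟩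
      obtain ⟨M, hM⟩ := isCompact_Icc.exists_bound_of_continuousOn (s := Set.Icc (1 / 2 : ℝ) (3 / 2))
        (f := Real.Gamma) (fun x hx => (Real.differentiableAt_Gamma fun m hm => by
          have := hx.1; linarith [(Nat.cast_nonneg m : (0 : ℝ) ≤ m)]).continuousAt.continuousWithinAt)
      refine Asymptotics.IsBigO.of_bound M ?_
      refine Filter.mem_inf_of_right fun w hw => ?_
      have hw1 : 1 / 2 < w.re := hw.1
      have hw2 : w.re < 3 / 2 := hw.2
      have hG : ‖Gamma w‖ ≤ M := (norm_Gamma_le_Gamma_re (by linarith)).trans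
        ((le_abs_self _).trans (hM _ ⟨hw1.le, hw2.le⟩))
      have hM0 : 0 ≤ M := (norm_nonneg _).trans hG
      show ‖F w‖ ≤ M * ‖Real.exp _‖
      rw [hFn, Real.norm_of_nonneg (Real.exp_pos _).le]
      have e1 : Real.exp (Real.pi * w.im / 2) ≤ Real.exp (Real.pi / 2 * Real.exp (1 * |w.im|)) := by
        rw [Real.exp_le_exp, mul_div_right_comm, one_mul]
        refine mul_le_mul_of_nonneg_left ?_ (by positivity)
        linarith [Real.add_one_le_exp |w.im|, le_abs_self w.im]
      have e2 : T ^ (1 / 2 - w.re) ≤ 1 := Real.rpow_le_one_of_one_le_of_nonpos hT (by linarith)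
      have e3 : T / ‖w + T‖ ≤ 1 := by
        rw [div_le_one (norm_pos_iff.2 (hne w (by linarith)))]
        linarith [hre w (by linarith)]
      calc _ ≤ M * Real.exp (Real.pi / 2 * Real.exp (1 * |w.im|)) * 1 * 1 := by gcongr
        _ = _ := by ring
    · intro w hw
      have hw' : w = 1 / 2 + w.im * I := by
        conv_lhs => rw [← re_add_im w, hw]
        simp
      have hG := norm_Gamma_half_add_mul_I_le w.im
      rw [← hw'] at hG
      rw [hFn, hw, sub_self, Real.rpow_zero, mul_one]
      have e3 : T / ‖w + T‖ ≤ 1 := by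
        rw [div_le_one (norm_pos_iff.2 (hne w (by linarith)))]
        linarith [hre w (by linarith)]
      calc _ ≤ (3 * Real.exp (-(Real.pi * |w.im| / 2))) * Real.exp (Real.pi * w.im / 2) * 1 := by
            gcongr
        _ = 3 * (Real.exp (-(Real.pi * |w.im| / 2)) * Real.exp (Real.pi * w.im / 2)) := by ring
        _ ≤ 9 / 2 := by linarith [hbd w.im]
    · intro w hw
      have hw' : w = 3 / 2 + w.im * I := by
        conv_lhs => rw [← re_add_im w, hw]
        simp
      have hG := norm_Gamma_three_halves_add_mul_I_le w.im
      rw [← hw'] at hG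
      have hpos : 0 < ‖w + T‖ := norm_pos_iff.2 (hne w (by linarith))
      have hT' : T ^ (1 / 2 - w.re) = T⁻¹ := by
        rw [hw, show (1 / 2 - 3 / 2 : ℝ) = -1 by norm_num, Real.rpow_neg_one]
      rw [hFn, hT', mul_assoc]
      have e3 : T⁻¹ * (T / ‖w + T‖) = 1 / ‖w + T‖ := by field_simp
      rw [e3]
      have e4 : (1 / 2 + |w.im|) / ‖w + T‖ ≤ 3 / 2 := by
        rw [div_le_iff₀ hpos]
        linarith [hre w (by linarith), him w]
      have e5 := hbd w.im
      calc _ ≤ (3 * (1 / 2 + |w.im|) * Real.exp (-(Real.pi * |w.im| / 2))) *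
            Real.exp (Real.pi * w.im / 2) * (1 / ‖w + T‖) := by
            gcongr
        _ = 3 * ((1 / 2 + |w.im|) / ‖w + T‖) *
            (Real.exp (-(Real.pi * |w.im| / 2)) * Real.exp (Real.pi * w.im / 2)) := by ring
        _ ≤ 3 * (3 / 2) * 1 := by gcongr
        _ = _ := by norm_num
  rw [hFn] at key
  have hpos : 0 < ‖s + T‖ := norm_pos_iff.2 (hne s (by linarith))
  have hsT : ‖s + T‖ ≤ 7 / 2 * T := by
    refine (norm_add_le _ _).trans ?_
    have := norm_le_abs_re_add_abs_im s
    rw [abs_of_nonneg (by linarith), abs_of_pos (show 0 < s.im from hT0)] at this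
    rw [norm_real, Real.norm_of_nonneg hT0.le]
    linarith
  have e6 : 2 / 7 ≤ T / ‖s + T‖ := by
    rw [le_div_iff₀ hpos]; linarith
  have e7 : ‖Gamma s‖ * Real.exp (Real.pi * T / 2) * T ^ (1 / 2 - s.re) ≤ 16 := by
    have := mul_le_mul_of_nonneg_left e6
      (show 0 ≤ ‖Gamma s‖ * Real.exp (Real.pi * T / 2) * T ^ (1 / 2 - s.re) by positivity)
    linarith
  calc ‖Gamma s‖ = (‖Gamma s‖ * Real.exp (Real.pi * T / 2) * T ^ (1 / 2 - s.re)) *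
        T ^ (s.re - 1 / 2) * Real.exp (-(Real.pi * T / 2)) := by
        rw [Real.exp_neg, show s.re - 1 / 2 = -(1 / 2 - s.re) by ring, Real.rpow_neg hT0.le]
        have : T ^ (1 / 2 - s.re) ≠ 0 := by positivity
        field_simp
    _ ≤ _ := by gcongr

theorem norm_Gamma_le_of_one_le_abs_im {s : ℂ} (h0 : 0 < s.re) (h1 : s.re < 1)
    (hT : 1 ≤ |s.im|) :
    ‖Gamma s‖ ≤ 16 * |s.im| ^ (s.re - 1 / 2) * Real.exp (-(Real.pi * |s.im| / 2)) := by
  wlog h : 0 ≤ s.im generalizing s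
  · have := this (s := (starRingEnd ℂ) s) (by simpa) (by simpa) (by simpa)
      (by simp; exact (not_le.1 h).le)
    rw [Gamma_conj] at this
    simpa using this
  rw [abs_of_nonneg h] at hT ⊢
  rcases le_total (1 / 2) s.re with h2 | h2
  · exact norm_Gamma_le_of_half_le_re h2 (by linarith) hT
  · have hs0 : s ≠ 0 := fun hs => by simp [hs] at h0
    have h3 := norm_Gamma_le_of_half_le_re (s := s + 1) (by simp; linarith) (by simp; linarith)
      (by simpa using hT)
    rw [Gamma_add_one _ hs0, norm_mul] at h3
    simp only [add_re, one_re, add_im, one_im, add_zero] at h3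
    have h4 : s.im ≤ ‖s‖ := (le_abs_self _).trans (abs_im_le_norm s)
    have him : 0 < s.im := by linarith
    rw [show s.re + 1 - 1 / 2 = (s.re - 1 / 2) + 1 by ring, Real.rpow_add_one him.ne'] at h3
    have h5 := mul_le_mul_of_nonneg_right h4 (norm_nonneg (Gamma s))
    refine le_of_mul_le_mul_left ?_ him
    linarith

theorem aestronglyMeasurable_cpow_mul_exp_neg_mul (a r : ℂ) :
    MeasureTheory.AEStronglyMeasurable (fun t : ℝ => (t : ℂ) ^ a * exp (-(r * t)))
      (MeasureTheory.volume.restrict (Set.Ioi 0)) := by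
  refine ContinuousOn.aestronglyMeasurable ?_ measurableSet_Ioi
  refine ContinuousOn.mul (fun t ht => ContinuousAt.continuousWithinAt ?_) (by fun_prop)
  exact continuousAt_ofReal_cpow_const _ _ (Or.inr (ne_of_gt ht))

theorem norm_cpow_mul_exp_neg_mul (a r : ℂ) {t : ℝ} (ht : 0 < t) :
    ‖(t : ℂ) ^ a * exp (-(r * t))‖ = t ^ a.re * Real.exp (-(r.re * t)) := by
  rw [norm_mul, norm_cpow_eq_rpow_re_of_pos ht, norm_exp]
  simp

theorem integrableOn_rpow_mul_exp_neg_mul {a r : ℝ} (ha : -1 < a) (hr : 0 < r) :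
    MeasureTheory.IntegrableOn (fun t : ℝ => t ^ a * Real.exp (-(r * t))) (Set.Ioi 0) := by
  simpa using integrableOn_rpow_mul_exp_neg_mul_rpow ha one_pos hr

theorem integrableOn_cpow_mul_exp_neg_mul {a r : ℂ} (ha : -1 < a.re) (hr : 0 < r.re) :
    MeasureTheory.IntegrableOn (fun t : ℝ => (t : ℂ) ^ a * exp (-(r * t))) (Set.Ioi 0) := by
  refine (integrableOn_rpow_mul_exp_neg_mul ha hr).mono'
    (aestronglyMeasurable_cpow_mul_exp_neg_mul a r) ?_
  filter_upwards [MeasureTheory.self_mem_ae_restrict measurableSet_Ioi] with t ht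
  exact (norm_cpow_mul_exp_neg_mul a r ht).le

theorem differentiableOn_integral_cpow_mul_exp_neg_mul {a : ℂ} (ha : -1 < a.re) :
    DifferentiableOn ℂ (fun r : ℂ => ∫ t : ℝ in Set.Ioi 0, (t : ℂ) ^ a * exp (-(r * t)))
      {r | 0 < r.re} := by
  intro r₀ hr₀
  have hr₀' : 0 < r₀.re := hr₀
  have hs : {r : ℂ | r₀.re / 2 < r.re} ∈ nhds r₀ :=
    (isOpen_lt continuous_const continuous_re).mem_nhds (half_lt_self hr₀')
  refine (hasDerivAt_integral_of_dominated_loc_of_deriv_le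
    (F' := fun r t => (t : ℂ) ^ a * (exp (-(r * t)) * (-(t : ℂ))))
    (bound := fun t => t ^ (a.re + 1) * Real.exp (-(r₀.re / 2 * t)))
    hs (.of_forall fun r => aestronglyMeasurable_cpow_mul_exp_neg_mul a r)
    (integrableOn_cpow_mul_exp_neg_mul ha hr₀) ?_ ?_
    (integrableOn_rpow_mul_exp_neg_mul (by linarith) (half_pos hr₀'))
    ?_).2.differentiableAt.differentiableWithinAt
  · have := (aestronglyMeasurable_cpow_mul_exp_neg_mul a r₀).mul
      (Complex.continuous_ofReal.neg.aestronglyMeasurable)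
    refine this.congr (.of_forall fun t => ?_)
    simp [mul_assoc]
  · filter_upwards [MeasureTheory.self_mem_ae_restrict measurableSet_Ioi] with t ht r hr
    have ht : 0 < t := ht
    rw [← mul_assoc, norm_mul, norm_cpow_mul_exp_neg_mul a r ht, norm_neg, norm_real,
      Real.norm_of_nonneg ht.le, Real.rpow_add_one ht.ne', mul_right_comm]
    have : r₀.re / 2 ≤ r.re := le_of_lt hr
    gcongr
  · refine .of_forall fun t r _ => ?_
    have := ((hasDerivAt_id r).mul_const (t : ℂ)).neg.cexp.const_mul ((t : ℂ) ^ a)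
    simpa using this

theorem integral_cpow_mul_exp_neg_mul_Ioi_of_re_pos {a r : ℂ} (ha : 0 < a.re) (hr : 0 < r.re) :
    ∫ t : ℝ in Set.Ioi 0, (t : ℂ) ^ (a - 1) * exp (-(r * t)) = r ^ (-a) * Gamma a := by
  have hopen : IsOpen {r : ℂ | 0 < r.re} := isOpen_lt continuous_const continuous_re
  have h1 : AnalyticOnNhd ℂ
      (fun r : ℂ => ∫ t : ℝ in Set.Ioi 0, (t : ℂ) ^ (a - 1) * exp (-(r * t))) {r | 0 < r.re} :=
    (differentiableOn_integral_cpow_mul_exp_neg_mul (by simpa using ha)).analyticOnNhd hopen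
  have h2 : AnalyticOnNhd ℂ (fun r : ℂ => r ^ (-a) * Gamma a) {r | 0 < r.re} := by
    refine DifferentiableOn.analyticOnNhd (fun r hr => ?_) hopen
    exact ((differentiableAt_id.cpow_const (Or.inl hr)).mul_const _).differentiableWithinAt
  refine h1.eqOn_of_preconnected_of_frequently_eq h2
    (convex_halfSpace_re_gt 0).isPreconnected (z₀ := 1) (by simp) ?_ hr
  have h3 : Filter.Tendsto (fun x : ℝ => (x : ℂ)) (nhdsWithin 1 {1}ᶜ) (nhdsWithin 1 {1}ᶜ) := by
    refine tendsto_nhdsWithin_iff.2 ⟨?_, ?_⟩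
    · exact (Complex.continuous_ofReal.tendsto' 1 1 (by simp)).mono_left nhdsWithin_le_nhds
    · filter_upwards [self_mem_nhdsWithin] with x hx
      simpa using hx
  refine h3.frequently (Filter.Eventually.frequently ?_)
  filter_upwards [nhdsWithin_le_nhds (lt_mem_nhds one_pos)] with x hx
  rw [integral_cpow_mul_exp_neg_mul_Ioi ha hx, one_div, inv_cpow, cpow_neg]
  rw [arg_ofReal_of_nonneg hx.le]
  exact Real.pi_ne_zero.symm

theorem norm_add_mul_I_rpow_neg_le {c : ℝ} (hc : 0 < c) {p : ℝ} (hp : 0 ≤ p) (y : ℝ) :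
    ‖(c : ℂ) + y * I‖ ^ (-p) ≤ (1 + 1 / c) ^ p * (1 + ‖y‖) ^ (-p) := by
  have h1 : c ≤ ‖(c : ℂ) + y * I‖ := by
    simpa using (le_abs_self _).trans (abs_re_le_norm ((c : ℂ) + y * I))
  have h2 : ‖y‖ ≤ ‖(c : ℂ) + y * I‖ := by
    simpa using abs_im_le_norm ((c : ℂ) + y * I)
  have h3 : 1 + ‖y‖ ≤ (1 + 1 / c) * ‖(c : ℂ) + y * I‖ := by
    have : 1 ≤ 1 / c * ‖(c : ℂ) + y * I‖ := by
      rw [one_div, inv_mul_eq_div, one_le_div hc]; exact h1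
    linarith
  have h4 : 0 < ‖(c : ℂ) + y * I‖ := hc.trans_le h1
  calc ‖(c : ℂ) + y * I‖ ^ (-p)
      = (1 + 1 / c) ^ p * ((1 + 1 / c) * ‖(c : ℂ) + y * I‖) ^ (-p) := by
        rw [Real.mul_rpow (by positivity) h4.le, ← mul_assoc, ← Real.rpow_add (by positivity)]
        simp
    _ ≤ _ := by
        refine mul_le_mul_of_nonneg_left ?_ (by positivity)
        exact Real.rpow_le_rpow_of_nonpos (by positivity) h3 (by linarith)

theorem integrable_norm_add_mul_I_rpow_neg {c : ℝ} (hc : 0 < c) {p : ℝ} (hp : 1 < p) :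
    MeasureTheory.Integrable fun y : ℝ => ‖(c : ℂ) + y * I‖ ^ (-p) := by
  have h := (integrable_one_add_norm (E := ℝ) (μ := MeasureTheory.volume) (r := p)
    (by simpa using hp)).const_mul ((1 + 1 / c) ^ p)
  refine h.mono' ?_ (.of_forall fun y => ?_)
  · exact (Measurable.pow_const (by fun_prop) _).aestronglyMeasurable
  · rw [Real.norm_of_nonneg (by positivity)]
    exact norm_add_mul_I_rpow_neg_le hc (by linarith) y

theorem aestronglyMeasurable_cpow_add_mul_I {c : ℝ} (hc : 0 < c) (w : ℂ) :
    MeasureTheory.AEStronglyMeasurable (fun y : ℝ => ((c : ℂ) + y * I) ^ w) := by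
  refine Continuous.aestronglyMeasurable (continuous_iff_continuousAt.2 fun y => ?_)
  exact ContinuousAt.cpow (by fun_prop) continuousAt_const (Or.inl (by simpa using hc))

theorem integrable_cpow_add_mul_I {c : ℝ} (hc : 0 < c) {w : ℂ} (hw : 1 < w.re) :
    MeasureTheory.Integrable fun y : ℝ => ((c : ℂ) + y * I) ^ (-w) := by
  refine ((integrable_norm_add_mul_I_rpow_neg hc hw).mul_const
    (Real.exp (Real.pi * |w.im|))).mono' (aestronglyMeasurable_cpow_add_mul_I hc _)
    (.of_forall fun y => ?_)
  have h0 : (c : ℂ) + y * I ≠ 0 := fun h => hc.ne' (by simpa using congrArg re h)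
  rw [norm_cpow_of_ne_zero h0, div_eq_mul_inv, ← Real.exp_neg, neg_im, neg_re, mul_neg, neg_neg]
  refine mul_le_mul_of_nonneg_left (Real.exp_le_exp.2 ?_) (by positivity)
  exact (le_abs_self _).trans ((abs_mul _ _).le.trans
    (mul_le_mul_of_nonneg_right (abs_arg_le_pi _) (abs_nonneg _)))

theorem integral_exp_mul_cpow_neg {c x : ℝ} (hc : 0 < c) (hx : 0 < x) {w : ℂ} (hw : 1 < w.re) :
    ∫ y : ℝ, exp (x * (c + y * I)) * ((c : ℂ) + y * I) ^ (-w)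
      = 2 * Real.pi * (x : ℂ) ^ (w - 1) / Gamma w := by
  have hw0 : 0 < w.re := one_pos.trans hw
  have hG : Gamma w ≠ 0 := Gamma_ne_zero_of_re_pos hw0
  set f : ℝ → ℂ := (Set.Ioi 0).indicator fun t : ℝ => (t : ℂ) ^ (w - 1) * exp (-(c * t)) with hf
  have hfi : MeasureTheory.Integrable f := by
    rw [hf, MeasureTheory.integrable_indicator_iff measurableSet_Ioi]
    exact integrableOn_cpow_mul_exp_neg_mul (by simpa using hw0) (by simpa using hc)
  have hF : FourierTransform.fourier f =
      fun ξ : ℝ => ((c : ℂ) + (2 * Real.pi * ξ : ℝ) * I) ^ (-w) * Gamma w := by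
    ext ξ
    rw [Real.fourier_eq', ← integral_cpow_mul_exp_neg_mul_Ioi_of_re_pos hw0 (by simpa using hc),
      ← MeasureTheory.integral_indicator measurableSet_Ioi]
    congr 1 with t
    by_cases ht : t ∈ Set.Ioi (0 : ℝ)
    · simp only [hf, Set.indicator_of_mem ht, smul_eq_mul]
      rw [mul_left_comm, ← exp_add]
      congr 2
      simp
      ring
    · simp [hf, Set.indicator_of_notMem ht]
  have hFi : MeasureTheory.Integrable (FourierTransform.fourier f) := by
    rw [hF]
    exact ((integrable_cpow_add_mul_I hc hw).comp_mul_left'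
      (R := 2 * Real.pi) (by positivity)).mul_const _
  have hcont : ContinuousAt f x := by
    have : ContinuousAt (fun t : ℝ => (t : ℂ) ^ (w - 1) * exp (-(c * t))) x :=
      (continuousAt_ofReal_cpow_const _ _ (Or.inr hx.ne')).mul (by fun_prop)
    refine this.congr ?_
    filter_upwards [lt_mem_nhds hx] with t ht
    rw [hf, Set.indicator_of_mem (Set.mem_Ioi.2 ht)]
  have key := hfi.fourierInv_fourier_eq hFi hcont
  rw [hF, Real.fourierInv_eq'] at key
  have hcv := MeasureTheory.Measure.integral_comp_mul_left
    (fun y : ℝ => exp (y * x * I) * (((c : ℂ) + y * I) ^ (-w) * Gamma w)) (2 * Real.pi)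
  have hkey : ∫ y : ℝ, exp (y * x * I) * (((c : ℂ) + y * I) ^ (-w) * Gamma w)
      = 2 * Real.pi * ((x : ℂ) ^ (w - 1) * exp (-(c * x))) := by
    rw [hf, Set.indicator_of_mem (Set.mem_Ioi.2 hx)] at key
    rw [← key]
    rw [abs_of_pos (by positivity), eq_inv_smul_iff₀ (by positivity)] at hcv
    rw [← hcv, real_smul]
    push_cast
    congr 2
    ext y
    simp
    left
    congr 1
    ring
  have hsplit (y : ℝ) : exp (x * (c + y * I)) * ((c : ℂ) + y * I) ^ (-w) =
      exp (c * x) / Gamma w * (exp (y * x * I) * (((c : ℂ) + y * I) ^ (-w) * Gamma w)) := by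
    rw [show (x : ℂ) * (c + y * I) = c * x + y * x * I by ring, exp_add]
    field_simp
  simp_rw [hsplit]
  rw [MeasureTheory.integral_const_mul, hkey, exp_neg]
  field_simp

theorem summable_zetaZeros_one_add_norm_rpow {p : ℝ} (hp : 1 < p) :
    Summable fun ρ : zetaZeros => (1 + ‖(ρ : ℂ)‖) ^ (-p) := by
  obtain ⟨K, -, hK⟩ := exists_card_zeros_le
  exact summable_one_add_norm_rpow_of_card_le hp fun m S hS => hK m S fun z hz =>
    ⟨entireXi_eq_zero_of_riemannZeta_eq_zero (hS z hz).1.1 (hS z hz).1.2.1 (hS z hz).1.2.2,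
      (hS z hz).2⟩

theorem countable_zetaZeros : Countable zetaZeros := by
  have h := (summable_zetaZeros_one_add_norm_rpow one_lt_two).countable_support
  rw [Function.support_eq_univ fun ρ => by positivity] at h
  exact Set.countable_univ_iff.1 h

theorem eventually_cofinite_one_le_abs_im : ∀ᶠ ρ : zetaZeros in Filter.cofinite,
    1 ≤ |(ρ : ℂ).im| := by
  have h := (summable_zetaZeros_one_add_norm_rpow one_lt_two).tendsto_cofinite_zero
  filter_upwards [h.eventually (gt_mem_nhds (show (0 : ℝ) < 3 ^ (-2 : ℝ) by positivity))] with ρ hρ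
  have h1 : 3 < 1 + ‖(ρ : ℂ)‖ := by
    by_contra hle
    exact hρ.not_ge (Real.rpow_le_rpow_of_nonpos (by positivity) (not_lt.1 hle) (by norm_num))
  have h2 := norm_le_abs_re_add_abs_im (ρ : ℂ)
  rw [abs_of_pos ρ.2.2.1] at h2
  linarith [ρ.2.2.2]

theorem abs_arg_le_pi_div_two_sub {z : ℂ} (hz : 0 < z.re) :
    |arg z| ≤ Real.pi / 2 - z.re / ‖z‖ := by
  have hz0 : z ≠ 0 := fun h => by simp [h] at hz
  have h1 : |arg z| < Real.pi / 2 := abs_arg_lt_pi_div_two_iff.2 (Or.inl hz)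
  have h2 : z.re / ‖z‖ = Real.sin (Real.pi / 2 - |arg z|) := by
    rw [Real.sin_pi_div_two_sub, Real.cos_abs, cos_arg hz0]
  have h3 := Real.sin_le (sub_nonneg.2 h1.le)
  linarith

theorem norm_cpow_neg_mul_exp_le {z : ℂ} (hz : 0 < z.re) (w : ℂ) :
    ‖z ^ (-w)‖ * Real.exp (-(Real.pi * |w.im| / 2)) ≤
      ‖z‖ ^ (-w.re) * Real.exp (-(z.re * |w.im| / ‖z‖)) := by
  have hz0 : z ≠ 0 := fun h => by simp [h] at hz
  rw [norm_cpow_of_ne_zero hz0, div_eq_mul_inv, ← Real.exp_neg, mul_assoc, ← Real.exp_add, neg_re,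
    neg_im]
  refine mul_le_mul_of_nonneg_left (Real.exp_le_exp.2 ?_) (by positivity)
  have h1 : arg z * w.im ≤ |arg z| * |w.im| := (le_abs_self _).trans (abs_mul _ _).le
  have h2 := mul_le_mul_of_nonneg_right (abs_arg_le_pi_div_two_sub hz) (abs_nonneg w.im)
  have h3 : z.re / ‖z‖ * |w.im| = z.re * |w.im| / ‖z‖ := by ring
  rw [sub_mul, h3] at h2
  linarith

theorem rpow_mul_exp_neg_le {x p : ℝ} {P : ℕ} (hx : 0 < x) (hp : 0 ≤ p) (hP : p ≤ P) :
    x ^ p * Real.exp (-x) ≤ 1 + P.factorial := by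
  have h1 : x ^ p ≤ 1 + x ^ P := by
    rcases le_total x 1 with h | h
    · have := Real.rpow_le_one hx.le h hp
      have : 0 ≤ x ^ P := by positivity
      linarith
    · have := Real.rpow_le_rpow_of_exponent_le h hP
      rw [Real.rpow_natCast] at this
      linarith
  have h2 := Real.pow_div_factorial_le_exp x hx.le P
  rw [div_le_iff₀ (by positivity)] at h2
  have h3 : 1 ≤ Real.exp x := Real.one_le_exp hx.le
  rw [Real.exp_neg, ← div_eq_mul_inv, div_le_iff₀ (Real.exp_pos x)]
  linarith

theorem norm_cpow_neg_mul_Gamma_le {z s : ℂ} {k : ℝ} {P : ℕ} (hz : 0 < z.re) (hz1 : z.re ≤ 1)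
    (hk : -1 / 2 < k) (hP : k + 2 ≤ P) (h0 : 0 < s.re) (h1 : s.re < 1) (hT : 1 ≤ |s.im|) :
    ‖z ^ (-((k : ℂ) + 2 + s)) * Gamma s‖ ≤ 16 * (1 + P.factorial) * (z.re ^ P)⁻¹ *
      |s.im| ^ (-(k / 2 + 5 / 4)) * ‖z‖ ^ (-(k / 2 + 5 / 4)) := by
  have hz0 : 0 < ‖z‖ := norm_pos_iff.2 fun h => by simp [h] at hz
  have hT0 : 0 < |s.im| := by linarith
  set p : ℝ := s.re + k / 2 + 3 / 4 with hp
  set x : ℝ := z.re * |s.im| / ‖z‖ with hx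
  have hx0 : 0 < x := by positivity
  have e1 := norm_cpow_neg_mul_exp_le hz ((k : ℂ) + 2 + s)
  have him : ((k : ℂ) + 2 + s).im = s.im := by simp
  have hre : ((k : ℂ) + 2 + s).re = k + 2 + s.re := by simp
  rw [him, hre, ← hx] at e1
  have e2 := rpow_mul_exp_neg_le (p := p) (P := P) hx0 (by linarith) (by linarith)
  have e3 : |s.im| ^ (s.re - 1 / 2) * ‖z‖ ^ (-(k + 2 + s.re)) = x ^ p * (z.re ^ p)⁻¹ *
      |s.im| ^ (-(k / 2 + 5 / 4)) * ‖z‖ ^ (-(k / 2 + 5 / 4)) := by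
    rw [hx, Real.div_rpow (by positivity) hz0.le, Real.mul_rpow hz.le hT0.le,
      show s.re - 1 / 2 = p + -(k / 2 + 5 / 4) by rw [hp]; ring,
      show -(k + 2 + s.re) = -p + -(k / 2 + 5 / 4) by rw [hp]; ring,
      Real.rpow_add hT0, Real.rpow_add hz0 (-p), Real.rpow_neg hz0.le p]
    have : z.re ^ p ≠ 0 := by positivity
    field_simp
  have e4 : (z.re ^ p)⁻¹ ≤ (z.re ^ P)⁻¹ := by
    rw [← Real.rpow_natCast]
    have := Real.rpow_le_rpow_of_exponent_ge hz hz1 (show p ≤ P by linarith)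
    gcongr
  calc ‖z ^ (-((k : ℂ) + 2 + s)) * Gamma s‖
      ≤ ‖z ^ (-((k : ℂ) + 2 + s))‖ *
        (16 * |s.im| ^ (s.re - 1 / 2) * Real.exp (-(Real.pi * |s.im| / 2))) := by
        rw [norm_mul]
        gcongr
        exact norm_Gamma_le_of_one_le_abs_im h0 h1 hT
    _ = 16 * |s.im| ^ (s.re - 1 / 2) *
        (‖z ^ (-((k : ℂ) + 2 + s))‖ * Real.exp (-(Real.pi * |s.im| / 2))) := by ring
    _ ≤ 16 * |s.im| ^ (s.re - 1 / 2) * (‖z‖ ^ (-(k + 2 + s.re)) * Real.exp (-x)) := by gcongr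
    _ = 16 * (|s.im| ^ (s.re - 1 / 2) * ‖z‖ ^ (-(k + 2 + s.re))) * Real.exp (-x) := by ring
    _ = 16 * (x ^ p * Real.exp (-x)) * (z.re ^ p)⁻¹ * |s.im| ^ (-(k / 2 + 5 / 4)) *
        ‖z‖ ^ (-(k / 2 + 5 / 4)) := by rw [e3]; ring
    _ ≤ _ := by gcongr

theorem abs_im_rpow_neg_le {s : ℂ} {p : ℝ} (hp : 0 ≤ p) (h0 : 0 < s.re) (h1 : s.re < 1)
    (hT : 1 ≤ |s.im|) : |s.im| ^ (-p) ≤ 3 ^ p * (1 + ‖s‖) ^ (-p) := by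
  have h2 : (1 + ‖s‖) / 3 ≤ |s.im| := by
    have := norm_le_abs_re_add_abs_im s
    rw [abs_of_pos h0] at this
    linarith
  calc |s.im| ^ (-p) ≤ ((1 + ‖s‖) / 3) ^ (-p) :=
        Real.rpow_le_rpow_of_nonpos (by positivity) h2 (by linarith)
    _ = _ := by
        rw [Real.div_rpow (by positivity) (by norm_num), Real.rpow_neg (by norm_num : (0 : ℝ) ≤ 3),
          div_inv_eq_mul, mul_comm]

theorem integrable_exp_mul_cpow_neg_mul {c x : ℝ} (hc : 0 < c) {w : ℂ} (hw : 1 < w.re) (G : ℂ) :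
    MeasureTheory.Integrable fun y : ℝ =>
      exp (x * (c + y * I)) * (((c : ℂ) + y * I) ^ (-w) * G) := by
  refine (((integrable_cpow_add_mul_I hc hw).mul_const G).norm.const_mul
    (Real.exp (x * c))).mono' ?_ (.of_forall fun y => ?_)
  · exact (Continuous.aestronglyMeasurable (by fun_prop)).mul
      ((aestronglyMeasurable_cpow_add_mul_I hc _).mul_const G)
  · rw [norm_mul, norm_exp]
    simp

theorem summable_integral_norm_zetaZeros {c x k : ℝ} (hc : 0 < c) (hc1 : c ≤ 1)
    (hk : -1 / 2 < k) :
    Summable fun ρ : zetaZeros => ∫ y : ℝ,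
      ‖exp (x * (c + y * I)) * (((c : ℂ) + y * I) ^ (-((k : ℂ) + 2 + ρ)) * Gamma ρ)‖ := by
  obtain ⟨P, hP⟩ := exists_nat_ge (k + 2)
  set p : ℝ := k / 2 + 5 / 4 with hp
  have hp1 : 1 < p := by linarith
  set A : ℝ := Real.exp (x * c) * (16 * (1 + P.factorial) * (c ^ P)⁻¹ * 3 ^ p) *
    ∫ y : ℝ, ‖(c : ℂ) + y * I‖ ^ (-p) with hA
  refine ((summable_zetaZeros_one_add_norm_rpow hp1).mul_left A).of_norm_bounded_eventually ?_
  filter_upwards [eventually_cofinite_one_le_abs_im] with ρ hρ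
  rw [Real.norm_of_nonneg (by positivity)]
  calc _ ≤ ∫ y : ℝ, Real.exp (x * c) * (16 * (1 + P.factorial) * (c ^ P)⁻¹ * 3 ^ p) *
        (1 + ‖(ρ : ℂ)‖) ^ (-p) * ‖(c : ℂ) + y * I‖ ^ (-p) := by
        refine MeasureTheory.integral_mono
          (integrable_exp_mul_cpow_neg_mul hc
            (by simp only [add_re, ofReal_re, re_ofNat]; linarith [ρ.2.2.1]) _).norm
          ((integrable_norm_add_mul_I_rpow_neg hc hp1).const_mul _) fun y => ?_
        have h1 := norm_cpow_neg_mul_Gamma_le (z := c + y * I) (s := ρ) (by simpa) (by simpa) hk hP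
          ρ.2.2.1 ρ.2.2.2 hρ
        rw [← hp, show ((c : ℂ) + y * I).re = c by simp] at h1
        have h2 := abs_im_rpow_neg_le (p := p) (by linarith) ρ.2.2.1 ρ.2.2.2 hρ
        have h3 : ‖exp (x * (c + y * I))‖ = Real.exp (x * c) := by rw [norm_exp]; simp
        simp only [norm_mul (exp _), h3]
        calc _ ≤ Real.exp (x * c) * (16 * (1 + P.factorial) * (c ^ P)⁻¹ *
              (3 ^ p * (1 + ‖(ρ : ℂ)‖) ^ (-p)) * ‖(c : ℂ) + y * I‖ ^ (-p)) := by
              refine mul_le_mul_of_nonneg_left (h1.trans ?_) (Real.exp_pos _).le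
              gcongr
          _ = _ := by ring
    _ = A * (1 + ‖(ρ : ℂ)‖) ^ (-p) := by
        rw [MeasureTheory.integral_const_mul, hA]; ring

theorem integral_tsum_zetaZeros {c x k : ℝ} (hc : 0 < c) (hc1 : c ≤ 1) (hx : 0 < x)
    (hk : -1 / 2 < k) :
    ∫ y : ℝ, ∑' ρ : zetaZeros,
      exp (x * (c + y * I)) * (((c : ℂ) + y * I) ^ (-((k : ℂ) + 2 + ρ)) * Gamma ρ) =
    2 * Real.pi * (x : ℂ) ^ ((k : ℂ) + 1) *
      ∑' ρ : zetaZeros, (x : ℂ) ^ (ρ : ℂ) * Gamma ρ / Gamma ((k : ℂ) + 2 + ρ) := by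
  have := countable_zetaZeros
  have hre (ρ : zetaZeros) : 1 < ((k : ℂ) + 2 + ρ).re := by
    simp only [add_re, ofReal_re, re_ofNat]; linarith [ρ.2.2.1]
  rw [← MeasureTheory.integral_tsum_of_summable_integral_norm
    (fun ρ => integrable_exp_mul_cpow_neg_mul hc (hre ρ) _)
    (summable_integral_norm_zetaZeros hc hc1 hk), ← tsum_mul_left]
  congr 1 with ρ
  simp_rw [← mul_assoc]
  rw [MeasureTheory.integral_mul_const, integral_exp_mul_cpow_neg hc hx (hre ρ),
    show (k : ℂ) + 2 + ρ - 1 = (k + 1) + ρ by ring, cpow_add _ _ (ofReal_ne_zero.2 hx.ne')]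
  ring

/-- Evaluation of `I₂`: absolute convergence and
`(1/(8i)) ∫_{(1/N)} e^{Nz} z^{-k-2} ∑_ρ z^{-ρ} Γ(ρ) dz
  = (N^{k+1} π / 4) ∑_ρ N^ρ Γ(ρ)/Γ(k+2+ρ)`. -/
theorem I2_evaluation (N : ℕ) (hN : 1 < N) (k : ℝ) (hk : -1 / 2 < k) :
    Summable (fun ρ : zetaZeros =>
      ∫ y : ℝ,
        ‖Complex.exp ((N : ℂ) * ((1 / (N : ℂ)) + y * Complex.I)) *
            ((1 / (N : ℂ)) + y * Complex.I) ^ (-(k : ℂ) - 2) *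
              ((1 / (N : ℂ)) + y * Complex.I) ^ (-(ρ : ℂ)) * Complex.Gamma (ρ : ℂ)‖) ∧
    (1 / (8 * Complex.I)) *
        (∫ y : ℝ,
          Complex.exp ((N : ℂ) * ((1 / (N : ℂ)) + y * Complex.I)) *
            ((1 / (N : ℂ)) + y * Complex.I) ^ (-(k : ℂ) - 2) *
              (∑' ρ : zetaZeros,
                ((1 / (N : ℂ)) + y * Complex.I) ^ (-(ρ : ℂ)) * Complex.Gamma (ρ : ℂ)) *
                Complex.I)
      = (N : ℂ) ^ ((k : ℂ) + 1) * (Real.pi : ℂ) / 4 *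
          ∑' ρ : zetaZeros,
            (N : ℂ) ^ (ρ : ℂ) * Complex.Gamma (ρ : ℂ) /
              Complex.Gamma ((k : ℂ) + 2 + (ρ : ℂ)) := by
  have hN0 : (0 : ℝ) < N := by positivity
  have hc : (0 : ℝ) < 1 / N := by positivity
  have hc1 : (1 / N : ℝ) ≤ 1 := by
    rw [div_le_one hN0]; exact_mod_cast hN.le
  have hcast : (1 / (N : ℂ)) = ((1 / N : ℝ) : ℂ) := by push_cast; rfl
  have hsplit (y : ℝ) (ρ : ℂ) :
      (((1 / N : ℝ) : ℂ) + y * I) ^ (-(k : ℂ) - 2) * (((1 / N : ℝ) : ℂ) + y * I) ^ (-ρ) =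
        (((1 / N : ℝ) : ℂ) + y * I) ^ (-((k : ℂ) + 2 + ρ)) := by
    have h0 : ((1 / N : ℝ) : ℂ) + y * I ≠ 0 := fun h => hc.ne' (by simpa using congrArg re h)
    rw [← cpow_add _ _ h0]
    congr 1; ring
  rw [hcast]
  constructor
  · refine (summable_integral_norm_zetaZeros (x := N) hc hc1 hk).congr fun ρ => ?_
    simp_rw [mul_assoc (exp _), hsplit, ← mul_assoc, ofReal_natCast]
  · have h := integral_tsum_zetaZeros hc hc1 hN0 hk
    rw [ofReal_natCast] at h
    have hint : ∀ y : ℝ, exp ((N : ℂ) * (((1 / N : ℝ) : ℂ) + y * I)) *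
          (((1 / N : ℝ) : ℂ) + y * I) ^ (-(k : ℂ) - 2) *
            (∑' ρ : zetaZeros, (((1 / N : ℝ) : ℂ) + y * I) ^ (-(ρ : ℂ)) * Gamma (ρ : ℂ)) =
        ∑' ρ : zetaZeros, exp ((N : ℂ) * (((1 / N : ℝ) : ℂ) + y * I)) *
          ((((1 / N : ℝ) : ℂ) + y * I) ^ (-((k : ℂ) + 2 + ρ)) * Gamma ρ) := by
      intro y
      rw [← tsum_mul_left]
      congr 1 with ρ
      rw [← hsplit]
      ring
    rw [MeasureTheory.integral_mul_const, MeasureTheory.integral_congr_ae (.of_forall hint), h]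
    field_simp
    ring

end
end
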